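/- arXiv:2603.16613 — 6 statements merged into one kernel-verified Lean document; each statement's English description precedes it below -/
import Mathlib

section
/- Let G be a reflexive digraph admitting a Hobby–McKenzie polymorphism. Then the strong equivalence of G coincides with the extreme equivalence of G; equivalently, every strong component of G is extremely connected. -/
namespace DigraphHM0

/-- `f` is a polymorphism of the digraph `(V, E)`. -/
def IsPoly {V : Type*} (E : V → V → Prop) {n : ℕ} (f : (Fin n → V) → V) : Prop :=
  ∀ a b : Fin n → V, (∀ i, E (a i) (b i)) → E (f a) (f b)

/-- `f` is idempotent. -/
def IsIdem {V : Type*} {n : ℕ} (f : (Fin n → V) → V) : Prop :=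
  ∀ x : V, f (fun _ => x) = x

/-- `t` is a Hobby–McKenzie operation: it is idempotent and for each `i` it satisfies a
linear identity in two variables `x, y` whose left side has `x` in the first `i+1`
coordinates and whose right side has `y` in coordinate `i` (the other coordinates being
arbitrary choices of `x` or `y`, encoded by the boolean matrices `L` and `R`), such that
no operation `a ↦ min_{k ∈ I} a k` (for nonempty `I`) on the two-element chain
`false < true` satisfies all `n` of these identities. -/
def IsHobbyMcKenzie {V : Type*} {n : ℕ} (t : (Fin n → V) → V) : Prop :=
  IsIdem t ∧
  ∃ L R : Fin n → Fin n → Bool,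
    (∀ i j : Fin n, j ≤ i → L i j = false) ∧
    (∀ i : Fin n, R i i = true) ∧
    (∀ i : Fin n, ∀ x y : V,
      t (fun j => cond (L i j) y x) = t (fun j => cond (R i j) y x)) ∧
    ¬ ∃ I : Finset (Fin n), I.Nonempty ∧
        ∀ i : Fin n, ∀ x y : Bool,
          decide (∀ k ∈ I, cond (L i k) y x = true) =
          decide (∀ k ∈ I, cond (R i k) y x = true)

/-- One step of a symmetric path: edges in both directions. -/
def SymStep {V : Type*} (E : V → V → Prop) : V → V → Prop :=
  fun u v => E u v ∧ E v u

/-- The extreme equivalence: being connected by a symmetric path. -/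
def ExtremeEq {V : Type*} (E : V → V → Prop) : V → V → Prop :=
  Relation.ReflTransGen (SymStep E)

/-- The strong equivalence: directed paths both ways. -/
def StrongEq {V : Type*} (E : V → V → Prop) : V → V → Prop :=
  fun a b => Relation.ReflTransGen E a b ∧ Relation.ReflTransGen E b a

open Relation

/-- The table form of the Hobby–McKenzie identities, without the semilattice clause. -/
structure SatisfiesTable {V : Type*} {n : ℕ} (t : (Fin n → V) → V)
    (L R : Fin n → Fin n → Bool) : Prop where
  idem : IsIdem t
  left_eq_false : ∀ i j : Fin n, j ≤ i → L i j = false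
  right_diag : ∀ i : Fin n, R i i = true
  identity : ∀ i : Fin n, ∀ x y : V,
    t (fun j => cond (L i j) y x) = t (fun j => cond (R i j) y x)

/-- `t` evaluated with `y` on the coordinates in `S` and `x` elsewhere. -/
def blend {V : Type*} {n : ℕ} (t : (Fin n → V) → V) (S : Fin n → Bool) (y x : V) : V :=
  t (fun j => cond (S j) y x)

/-- `t` evaluated with `a` at `i`, `y` on the other coordinates in `S`, and `x` elsewhere. -/
def blendAt {V : Type*} {n : ℕ} (t : (Fin n → V) → V) (i : Fin n) (S : Fin n → Bool)
    (a y x : V) : V :=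
  t (fun j => if j = i then a else cond (S j) y x)

/-- Composition of a relation with its own symmetric part. -/
def compSymStep {V : Type*} (E : V → V → Prop) (u w : V) : Prop :=
  ∃ v, E u v ∧ SymStep E v w

section Blend

variable {V : Type*} {n : ℕ} {t : (Fin n → V) → V} {E : V → V → Prop}
  {S T : Fin n → Bool} {i : Fin n} {a b c a' b' c' v : V}

theorem blend_self (hid : IsIdem t) : blend t S v v = v := by
  simpa [blend] using hid v

theorem blendAt_self (hid : IsIdem t) : blendAt t i S v v v = v := by
  simpa [blendAt] using hid v

theorem blend_false (hid : IsIdem t) : blend t (fun _ => false) b c = c := hid c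

theorem blend_true (hid : IsIdem t) : blend t (fun _ => true) b c = b := hid b

theorem blend_update : blend t (Function.update S i true) b c = blendAt t i S b b c := by
  unfold blend blendAt
  congr 1
  funext j
  by_cases hj : j = i <;> simp [hj]

theorem blendAt_eq_blend (hi : S i = true) : blendAt t i S b b c = blend t S b c := by
  rw [← blend_update, ← hi, Function.update_eq_self]

theorem blendAt_eq_blend' (hi : S i = false) : blendAt t i S c b c = blend t S b c := by
  unfold blend blendAt
  congr 1
  funext j
  by_cases hj : j = i <;> simp [hj, hi]

theorem blendAt_const : blendAt t i S a c c = blendAt t i T a c c := by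
  simp [blendAt]

theorem IsPoly.blend (hp : IsPoly E t) (hb : E b b') (hc : E c c') :
    E (blend t S b c) (blend t S b' c') :=
  hp _ _ fun j => by cases S j <;> assumption

theorem IsPoly.blendAt (hp : IsPoly E t) (ha : E a a') (hb : E b b') (hc : E c c') :
    E (blendAt t i S a b c) (blendAt t i S a' b' c') :=
  hp _ _ fun j => by
    by_cases hj : j = i
    · simpa [hj] using ha
    · cases hS : S j <;> simpa [hj]

theorem IsPoly.blendAt_blend (hp : IsPoly E t) (hi : S i = false) (ha : E a c') (hb : E b b')
    (hc : E c c') : E (DigraphHM0.blendAt t i S a b c) (DigraphHM0.blend t S b' c') := by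
  rw [← blendAt_eq_blend' (t := t) (b := b') (c := c') hi]
  exact hp.blendAt ha hb hc

theorem IsPoly.blend_blendAt (hp : IsPoly E t) (hi : S i = false) (ha : E c a') (hb : E b b')
    (hc : E c c') : E (DigraphHM0.blend t S b c) (DigraphHM0.blendAt t i S a' b' c') := by
  rw [← blendAt_eq_blend' (t := t) (b := b) (c := c) hi]
  exact hp.blendAt ha hb hc

theorem IsPoly.blendAt_blend_of_true (hp : IsPoly E t) (hi : T i = true) (ha : E a b')
    (hbb : E b b') (hbc : E b c') (hcb : E c b') (hcc : E c c') :
    E (DigraphHM0.blendAt t i S a b c) (DigraphHM0.blend t T b' c') :=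
  hp _ _ fun j => by
    by_cases hj : j = i
    · simpa [hj, hi] using ha
    · cases hS : S j <;> cases hT : T j <;> simpa [hj]

theorem IsPoly.blend_right (hp : IsPoly E t) (hid : IsIdem t) (hb : E b v) (hc : E c v) :
    E (DigraphHM0.blend t S b c) v := by
  simpa only [blend_self hid] using hp.blend (S := S) hb hc

theorem IsPoly.blendAt_right (hp : IsPoly E t) (hid : IsIdem t) (ha : E a v) (hb : E b v)
    (hc : E c v) : E (DigraphHM0.blendAt t i S a b c) v := by
  simpa only [blendAt_self hid] using hp.blendAt (i := i) (S := S) ha hb hc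

theorem SatisfiesTable.blend_eq {L R : Fin n → Fin n → Bool} (h : SatisfiesTable t L R)
    (i : Fin n) (y x : V) : DigraphHM0.blend t (L i) y x = DigraphHM0.blend t (R i) y x :=
  h.identity i x y

end Blend

/-- To reach the full index set from the empty one it suffices to be able to add the least
element of a set, given the property for all sets lying strictly above that element. -/
theorem boolFun_induction {n : ℕ} (P : (Fin n → Bool) → Prop) (h0 : P (fun _ => false))
    (step : ∀ i S, (∀ j ≤ i, S j = false) → (∀ T : Fin n → Bool, (∀ j ≤ i, T j = false) → P T) →
      P (Function.update S i true)) : P (fun _ => true) := by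
  have key : ∀ k ≤ n, ∀ S : Fin n → Bool, (∀ j : Fin n, j.val < n - k → S j = false) → P S := by
    intro k
    induction k with
    | zero =>
      intro _ S hS
      have : S = fun _ => false := funext fun j => hS j (by omega)
      rwa [this]
    | succ k ih =>
      intro hk S hS
      let i : Fin n := ⟨n - (k + 1), by omega⟩
      have below : ∀ T : Fin n → Bool, (∀ j ≤ i, T j = false) → P T := fun T hT =>
        ih (by omega) T fun j hj => hT j (by
          rw [Fin.le_def]
          change j.val ≤ n - (k + 1)
          omega)
      cases hi : S i with
      | false =>
        refine below S fun j hj => ?_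
        rcases hj.lt_or_eq with h | h
        · exact hS j h
        · rw [h, hi]
      | true =>
        have hupd : S = Function.update (Function.update S i false) i true := by
          rw [Function.update_idem, ← hi, Function.update_eq_self]
        rw [hupd]
        refine step i _ (fun j hj => ?_) below
        by_cases h : j = i
        · simp [h]
        · rw [Function.update_of_ne h]
          exact hS j (Fin.lt_def.mp (lt_of_le_of_ne hj h))
  exact key n le_rfl _ fun j hj => by omega

section Extreme

variable {V : Type*} {E : V → V → Prop} {a b c : V}

theorem SymStep.symm (h : SymStep E a b) : SymStep E b a := ⟨h.2, h.1⟩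

theorem SymStep.extremeEq (h : SymStep E a b) : ExtremeEq E a b := ReflTransGen.single h

theorem ExtremeEq.refl (a : V) : ExtremeEq E a a := ReflTransGen.refl

theorem ExtremeEq.symm (h : ExtremeEq E a b) : ExtremeEq E b a :=
  have : Std.Symm (SymStep E) := ⟨fun _ _ h => SymStep.symm h⟩
  ReflTransGen.stdSymm.symm _ _ h

theorem ExtremeEq.trans (hab : ExtremeEq E a b) (hbc : ExtremeEq E b c) : ExtremeEq E a c :=
  ReflTransGen.trans hab hbc

theorem IsPoly.symStep {n : ℕ} {t : (Fin n → V) → V} (hp : IsPoly E t) : IsPoly (SymStep E) t :=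
  fun a b h => ⟨hp a b fun i => (h i).1, hp b a fun i => (h i).2⟩

/-- The reflexive transitive closure of a reflexive relation inherits its polymorphisms. -/
theorem IsPoly.reflTransGen {n : ℕ} {t : (Fin n → V) → V} (hr : ∀ v, E v v) (hp : IsPoly E t) :
    IsPoly (ReflTransGen E) t := by
  intro a b h
  have key : ∀ s : Finset (Fin n), ReflTransGen E (t a) (t (s.piecewise b a)) := by
    intro s
    induction s using Finset.induction_on with
    | empty => simpa using ReflTransGen.refl
    | insert i s hi ih =>
      refine ih.trans ?_
      rw [Finset.piecewise_insert]
      have hs : s.piecewise b a = Function.update (s.piecewise b a) i (a i) := by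
        rw [eq_comm, Function.update_eq_self_iff, Finset.piecewise_eq_of_notMem _ _ _ hi]
      conv_lhs => rw [hs]
      refine ReflTransGen.lift (fun z => t (Function.update (s.piecewise b a) i z)) ?_ _ _ (h i)
      intro z w hzw
      refine hp _ _ fun j => ?_
      by_cases hj : j = i
      · subst hj
        simpa using hzw
      · simpa [hj] using hr _
  simpa using key Finset.univ

theorem IsPoly.extremeEq {n : ℕ} {t : (Fin n → V) → V} (hr : ∀ v, E v v) (hp : IsPoly E t) :
    IsPoly (ExtremeEq E) t :=
  IsPoly.reflTransGen (fun v => ⟨hr v, hr v⟩) hp.symStep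

theorem extremeEq_strongEq (h : ExtremeEq E a b) : StrongEq E a b :=
  ⟨ReflTransGen.mono (fun _ _ h => h.1) _ _ h, ReflTransGen.mono (fun _ _ h => h.1) _ _ h.symm⟩

end Extreme

section Table

variable {V : Type*} {n : ℕ} {t : (Fin n → V) → V} {L R : Fin n → Fin n → Bool}
  {E : V → V → Prop}

theorem extremeEq_of_square (hr : ∀ v, E v v) (hp : IsPoly E t) (ht : SatisfiesTable t L R)
    {p₂ q p z : V} (hp₂q : E p₂ q) (hqp : E q p) (hpz : E p z) (hpp : SymStep E p p₂)
    (hqz : SymStep E q z) : ExtremeEq E p q := by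
  have hx := hp.extremeEq hr
  have hid := ht.idem
  suffices H : ExtremeEq E p (blend t (fun _ => true) q p) by rwa [blend_true hid] at H
  refine boolFun_induction (fun S => ExtremeEq E p (blend t S q p)) ?_ ?_
  · simpa only [blend_false hid] using ExtremeEq.refl p
  intro i S hS ih
  have hSi := hS i le_rfl
  set e := blend t (L i) q p with he
  set e' := blend t (L i) q p₂
  have hpe : ExtremeEq E p e := ih _ (ht.left_eq_false i)
  have hee' : SymStep E e e' := hp.symStep.blend ⟨hr q, hr q⟩ hpp
  have he'p : E e' p := hp.blend_right hid hqp hpp.2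
  have he'q : E e' q := hp.blend_right hid (hr q) hp₂q
  have hez : E e z := hp.blend_right hid hqz.1 hpz
  have hgv : E (blend t S q e) (blendAt t i S z q e') :=
    hp.blend_blendAt hSi hez (hr q) hee'.1
  have hve : E (blendAt t i S z q e') e := by
    rw [he, ht.blend_eq]
    exact hp.blendAt_blend_of_true (ht.right_diag i) hqz.2 (hr q) hqp he'q he'p
  have hvq : E (blendAt t i S z q e') q := hp.blendAt_right hid hqz.2 (hr q) he'q
  have hvg : E (blendAt t i S z q e') (blend t S q e) := by
    simpa only [blend_self hid] using hp.blend (S := S) hvq hve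
  have h1 : ExtremeEq E (blend t S q p) (blend t S q e) := hx.blend (ExtremeEq.refl q) hpe
  have h2 : ExtremeEq E (blendAt t i S z q e') (blendAt t i S q q p) :=
    hx.blendAt hqz.symm.extremeEq (ExtremeEq.refl q) (hee'.symm.extremeEq.trans hpe.symm)
  change ExtremeEq E p (blend t _ q p)
  rw [blend_update]
  exact (ih S hS).trans (h1.trans ((SymStep.extremeEq ⟨hgv, hvg⟩).trans h2))

theorem extremeEq_of_symStep_cycle (hr : ∀ v, E v v) (hp : IsPoly E t)
    (ht : SatisfiesTable t L R) {x a b : V} (hxa : E x a) (hab : SymStep E a b) (hbx : E b x) :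
    ExtremeEq E x a := by
  have hx := hp.extremeEq hr
  have hid := ht.idem
  suffices H : ExtremeEq E x (blend t (fun _ => true) a x) by rwa [blend_true hid] at H
  refine boolFun_induction (fun S => ExtremeEq E x (blend t S a x)) ?_ ?_
  · simpa only [blend_false hid] using ExtremeEq.refl x
  intro i S hS ih
  have hSi := hS i le_rfl
  set c := blend t (L i) a x with hc
  set d := blend t (L i) b x
  have hxc : ExtremeEq E x c := ih _ (ht.left_eq_false i)
  have hcd : SymStep E c d := hp.symStep.blend hab ⟨hr x, hr x⟩
  have hdx : E d x := hp.blend_right hid hbx (hr x)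
  have hda : E d a := hp.blend_right hid hab.2 hxa
  have hca : E c a := hp.blend_right hid (hr a) hxa
  set v := blendAt t i S a b d
  have hvc : E v c := by
    rw [hc, ht.blend_eq]
    exact hp.blendAt_blend_of_true (ht.right_diag i) (hr a) hab.2 hbx hda hdx
  have hva : E v a := hp.blendAt_right hid (hr a) hab.2 hda
  have hvg' : E v (blend t S a c) := by
    simpa only [blend_self hid] using hp.blend (S := S) hva hvc
  have hgv : E (blend t S a d) v := hp.blend_blendAt hSi hda hab.1 (hr d)
  have hgg' : SymStep E (blend t S a c) (blend t S a d) :=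
    hp.symStep.blend ⟨hr a, hr a⟩ hcd
  have hg'z : E (blend t S a c) (blendAt t i S a a c) := hp.blend_blendAt hSi hca (hr a) (hr c)
  have hvz : SymStep E v (blendAt t i S a a c) :=
    hp.symStep.blendAt ⟨hr a, hr a⟩ hab.symm hcd.symm
  have hsq := extremeEq_of_square hr hp ht hgv hvg' hg'z hgg' hvz
  have h1 : ExtremeEq E (blend t S a x) (blend t S a c) := hx.blend (ExtremeEq.refl a) hxc
  have h2 : ExtremeEq E v (blendAt t i S a a x) :=
    hx.blendAt (ExtremeEq.refl a) hab.symm.extremeEq (hcd.symm.extremeEq.trans hxc.symm)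
  change ExtremeEq E x (blend t _ a x)
  rw [blend_update]
  exact (ih S hS).trans (h1.trans (hsq.trans h2))

theorem extremeEq_of_symStep_cycle₂ (hr : ∀ v, E v v) (hp : IsPoly E t)
    (ht : SatisfiesTable t L R) {x x' a b : V} (hxx : SymStep E x x') (hxa : E x a)
    (hab : SymStep E a b) (hbx : E b x') : ExtremeEq E x a := by
  have hx := hp.extremeEq hr
  have hid := ht.idem
  suffices H : ExtremeEq E x (blend t (fun _ => true) a x) by rwa [blend_true hid] at H
  refine boolFun_induction (fun S => ExtremeEq E x (blend t S a x)) ?_ ?_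
  · simpa only [blend_false hid] using ExtremeEq.refl x
  intro i S hS ih
  have hSi := hS i le_rfl
  set c := blend t (L i) a x' with hc
  set d := blend t (L i) b x
  have hcd : SymStep E c d := hp.symStep.blend hab hxx.symm
  have hxc : ExtremeEq E x c := (ih _ (ht.left_eq_false i)).trans
    (hx.blend (ExtremeEq.refl a) hxx.extremeEq)
  have hdx : E d x' := hp.blend_right hid hbx hxx.1
  have hda : E d a := hp.blend_right hid hab.2 hxa
  set v := blendAt t i S a b d
  have hvc : E v c := by
    rw [hc, ht.blend_eq]
    exact hp.blendAt_blend_of_true (ht.right_diag i) (hr a) hab.2 hbx hda hdx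
  have hva : E v a := hp.blendAt_right hid (hr a) hab.2 hda
  have hvg' : E v (blend t S a c) := by
    simpa only [blend_self hid] using hp.blend (S := S) hva hvc
  have hgv : E (blend t S a d) v := hp.blend_blendAt hSi hda hab.1 (hr d)
  have hgg' : SymStep E (blend t S a c) (blend t S a d) :=
    hp.symStep.blend ⟨hr a, hr a⟩ hcd
  have hcyc := extremeEq_of_symStep_cycle hr hp ht hvg' hgg' hgv
  have h1 : ExtremeEq E (blend t S a x) (blend t S a c) := hx.blend (ExtremeEq.refl a) hxc
  have h2 : ExtremeEq E v (blendAt t i S a a x) :=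
    hx.blendAt (ExtremeEq.refl a) hab.symm.extremeEq (hcd.symm.extremeEq.trans hxc.symm)
  change ExtremeEq E x (blend t _ a x)
  rw [blend_update]
  exact (ih S hS).trans (h1.trans (hcyc.symm.trans h2))

theorem IsPoly.compSymStep (hp : IsPoly E t) : IsPoly (compSymStep E) t := by
  intro a b h
  choose c hac hcb using h
  exact ⟨t c, hp a c hac, hp.symStep c b hcb⟩

theorem extremeEq_of_extremeEq_compSymStep (hr : ∀ v, E v v) (hp : IsPoly E t)
    (ht : SatisfiesTable t L R) {u v : V} (h : ExtremeEq (compSymStep E) u v) :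
    ExtremeEq E u v := by
  have hstep : ∀ u v, SymStep (compSymStep E) u v → ExtremeEq E u v := by
    rintro u v ⟨⟨u', huu', hu'v⟩, ⟨v', hvv', hv'u⟩⟩
    exact (extremeEq_of_symStep_cycle₂ hr hp ht hv'u.symm huu' hu'v hvv').trans hu'v.extremeEq
  induction h with
  | refl => exact ExtremeEq.refl _
  | tail _ h ih => exact ih.trans (hstep _ _ h)

theorem extremeEq_of_between (hr : ∀ v, E v v) (hp : IsPoly E t)
    (ht : SatisfiesTable t L R) {u v w : V} (huv : E u v) (hvw : E v w)
    (hwu : ExtremeEq E w u) : ExtremeEq E u v := by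
  have key : ∀ w, ReflTransGen (SymStep E) w u → ∀ F : V → V → Prop, (∀ v, F v v) →
      IsPoly F t → (∀ a b, SymStep E a b → SymStep F a b) → F u v → F v w →
      ExtremeEq F u v := by
    intro w hw
    induction hw using ReflTransGen.head_induction_on with
    | refl =>
      intro F _ _ _ huv hvu
      exact SymStep.extremeEq ⟨huv, hvu⟩
    | head hstep _ ih =>
      intro F hFr hFp hEF huv hvw
      have hFF : ∀ a b, F a b → compSymStep F a b := fun a b h => ⟨b, h, hFr b, hFr b⟩
      refine extremeEq_of_extremeEq_compSymStep hFr hFp ht ?_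
      exact ih (compSymStep F) (fun v => hFF v v (hFr v)) hFp.compSymStep
        (fun a b h => ⟨hFF a b (hEF a b h).1, hFF b a (hEF a b h).2⟩) (hFF _ _ huv)
        ⟨_, hvw, hEF _ _ hstep⟩
  exact key w hwu E hr hp (fun _ _ h => h) huv hvw

theorem extremeEq_of_between' (hr : ∀ v, E v v) (hp : IsPoly E t)
    (ht : SatisfiesTable t L R) {x u v w : V} (hxu : ExtremeEq E x u) (huv : E u v)
    (hvw : E v w) (hxw : ExtremeEq E x w) : ExtremeEq E x v :=
  hxu.trans (extremeEq_of_between hr hp ht huv hvw (hxw.symm.trans hxu))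

/-- All vertices of a closed directed walk are extremely connected. -/
theorem extremeEq_of_periodic_walk (hr : ∀ v, E v v) (hp : IsPoly E t)
    (ht : SatisfiesTable t L R) {w : ℕ → V} {m : ℕ} (hm : 0 < m)
    (hw : ∀ k, E (w k) (w (k + 1))) (hper : ∀ k, w (m * k) = w 0) (k : ℕ) :
    ExtremeEq E (w 0) (w k) := by
  have hid := ht.idem
  set x := w 0 with hx0
  suffices H : ∀ k, ExtremeEq E x (blend t (fun _ => true) (w k) x) by
    simpa only [blend_true hid] using H k
  refine boolFun_induction (fun S => ∀ k, ExtremeEq E x (blend t S (w k) x)) ?_ ?_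
  · intro k
    simpa only [blend_false hid] using ExtremeEq.refl x
  intro i S hS ih
  have hf : ∀ r k, ExtremeEq E x (blendAt t i (R i) (w k) (w (k + r)) x) := by
    intro r
    induction r with
    | zero =>
      intro k
      rw [Nat.add_zero, blendAt_eq_blend (ht.right_diag i), ← ht.blend_eq]
      exact ih _ (ht.left_eq_false i) k
    | succ r ihr =>
      intro k
      refine extremeEq_of_between' hr hp ht (ihr k) (hp.blendAt (hr _) (hw (k + r)) (hr x)) ?_
        (ihr (k + 1))
      rw [show k + 1 + r = k + (r + 1) by omega]
      exact hp.blendAt (hw k) (hr _) (hr x)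
  have hsingle : ∀ k, ExtremeEq E x (blendAt t i S (w k) x x) := by
    intro k
    have hle : k ≤ m * k := Nat.le_mul_of_pos_left k hm
    have h := hf (m * k - k) k
    rw [show k + (m * k - k) = m * k by omega, hper] at h
    rwa [blendAt_const (T := R i)]
  have hh : ∀ k l, ExtremeEq E x (blendAt t i S (w k) (w l) x) := by
    intro k
    induction k with
    | zero =>
      intro l
      rw [← hx0, blendAt_eq_blend' (hS i le_rfl)]
      exact ih S hS l
    | succ k ihk =>
      have hback : ∀ r l N, r + l = m * N →
          ExtremeEq E x (blendAt t i S (w (k + 1)) (w l) x) := by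
        intro r
        induction r with
        | zero =>
          intro l N hN
          rw [show l = m * N by omega, hper]
          exact hsingle (k + 1)
        | succ r ihr =>
          intro l N hN
          exact extremeEq_of_between' hr hp ht (ihk l) (hp.blendAt (hw k) (hr _) (hr x))
            (hp.blendAt (hr _) (hw l) (hr x)) (ihr (l + 1) N (by omega))
      intro l
      have hle : l ≤ m * l := Nat.le_mul_of_pos_left l hm
      exact hback (m * l - l) l l (by omega)
  intro k
  rw [blend_update]
  exact hh k k

end Table

theorem exists_walk_of_reflTransGen {V : Type*} {E : V → V → Prop} {a b : V}
    (h : ReflTransGen E a b) :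
    ∃ (m : ℕ) (f : ℕ → V), f 0 = a ∧ f m = b ∧ ∀ k < m, E (f k) (f (k + 1)) := by
  induction h with
  | refl => exact ⟨0, fun _ => a, rfl, rfl, fun k hk => absurd hk (Nat.not_lt_zero k)⟩
  | @tail b c _ hbc ih =>
    obtain ⟨m, f, h0, hm, hf⟩ := ih
    refine ⟨m + 1, fun k => if k ≤ m then f k else c, by simpa using h0, by simp, ?_⟩
    intro k hk
    rcases Nat.lt_succ_iff_lt_or_eq.mp hk with h | rfl
    · simpa [h.le, Nat.succ_le_iff.mpr h] using hf k h
    · simpa [hm] using hbc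

theorem extremeEq_of_edge {V : Type*} {n : ℕ} {t : (Fin n → V) → V} {L R : Fin n → Fin n → Bool}
    {E : V → V → Prop} (hr : ∀ v, E v v) (hp : IsPoly E t) (ht : SatisfiesTable t L R) {a b : V}
    (hab : E a b) (hba : ReflTransGen E b a) : ExtremeEq E a b := by
  obtain ⟨m, f, h0, hm, hf⟩ := exists_walk_of_reflTransGen hba
  have hw : ∀ k, E (f (k % (m + 1))) (f ((k + 1) % (m + 1))) := by
    intro k
    have hlt := Nat.mod_lt k (Nat.succ_pos m)
    rcases Nat.lt_succ_iff_lt_or_eq.mp hlt with h | h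
    · rw [show (k + 1) % (m + 1) = k % (m + 1) + 1 by
        rw [← Nat.mod_add_mod, Nat.mod_eq_of_lt (Nat.succ_lt_succ h)]]
      exact hf _ h
    · rw [show (k + 1) % (m + 1) = 0 by rw [← Nat.mod_add_mod, h, Nat.mod_self], h, hm, h0]
      exact hab
  have h := extremeEq_of_periodic_walk hr hp ht (w := fun k => f (k % (m + 1))) (Nat.succ_pos m)
    hw (fun k => by simp) m
  simp only [Nat.zero_mod, Nat.mod_eq_of_lt (Nat.lt_succ_self m), h0, hm] at h
  exact h.symm

/-- If a reflexive digraph admits a Hobby–McKenzie polymorphism, then its strong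
equivalence coincides with its extreme equivalence. -/
theorem strongEq_eq_extremeEq_of_hobbyMcKenzie {V : Type*} (E : V → V → Prop)
    (hrefl : ∀ v, E v v) {n : ℕ} (t : (Fin n → V) → V)
    (hpoly : IsPoly E t) (hHM : IsHobbyMcKenzie t) :
    ∀ a b : V, StrongEq E a b ↔ ExtremeEq E a b := by
  obtain ⟨hid, L, R, hL, hR, hLR, -⟩ := hHM
  have ht : SatisfiesTable t L R := ⟨hid, hL, hR, hLR⟩
  refine fun a b => ⟨fun h => ?_, extremeEq_strongEq⟩
  obtain ⟨hab, hba⟩ := h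
  induction hab using ReflTransGen.head_induction_on with
  | refl => exact ExtremeEq.refl b
  | head hac hcb ih =>
    exact (extremeEq_of_edge hrefl hpoly ht hac (hcb.trans hba)).trans
      (ih (hba.tail hac))

end DigraphHM0
end

section
/- Let G be a reflexive digraph admitting a Hobby–McKenzie polymorphism. Then the radical equivalence of G coincides with the extreme equivalence of G. -/
namespace DigraphHM1

/-- `f` is a polymorphism of the digraph `(V, E)`. -/
def IsPoly {V : Type*} (E : V → V → Prop) {n : ℕ} (f : (Fin n → V) → V) : Prop :=
  ∀ a b : Fin n → V, (∀ i, E (a i) (b i)) → E (f a) (f b)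

/-- `f` is idempotent. -/
def IsIdem {V : Type*} {n : ℕ} (f : (Fin n → V) → V) : Prop :=
  ∀ x : V, f (fun _ => x) = x

/-- `t` is a Hobby–McKenzie operation: it is idempotent and for each `i` it satisfies a
linear identity in two variables `x, y` whose left side has `x` in the first `i+1`
coordinates and whose right side has `y` in coordinate `i` (the other coordinates being
arbitrary choices of `x` or `y`, encoded by the boolean matrices `L` and `R`), such that
no operation `a ↦ min_{k ∈ I} a k` (for nonempty `I`) on the two-element chain
`false < true` satisfies all `n` of these identities. -/
def IsHobbyMcKenzie {V : Type*} {n : ℕ} (t : (Fin n → V) → V) : Prop :=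
  IsIdem t ∧
  ∃ L R : Fin n → Fin n → Bool,
    (∀ i j : Fin n, j ≤ i → L i j = false) ∧
    (∀ i : Fin n, R i i = true) ∧
    (∀ i : Fin n, ∀ x y : V,
      t (fun j => cond (L i j) y x) = t (fun j => cond (R i j) y x)) ∧
    ¬ ∃ I : Finset (Fin n), I.Nonempty ∧
        ∀ i : Fin n, ∀ x y : Bool,
          decide (∀ k ∈ I, cond (L i k) y x = true) =
          decide (∀ k ∈ I, cond (R i k) y x = true)

/-- One step of a symmetric path: edges in both directions. -/
def SymStep {V : Type*} (E : V → V → Prop) : V → V → Prop :=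
  fun u v => E u v ∧ E v u

/-- The extreme equivalence: being connected by a symmetric path. -/
def ExtremeEq {V : Type*} (E : V → V → Prop) : V → V → Prop :=
  Relation.ReflTransGen (SymStep E)

/-- The edge relation of the quotient digraph `G/ν`, pulled back to vertices:
`a → b` modulo `ν` iff some `a' ∈ a/ν` and `b' ∈ b/ν` satisfy `E a' b'`. -/
def SatEdge {V : Type*} (E ν : V → V → Prop) : V → V → Prop :=
  fun a b => ∃ a' b', ν a a' ∧ ν b b' ∧ E a' b'

/-- The increasing sequence `ν₀ ⊆ ν₁ ⊆ …` defining the radical equivalence: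
`ν₀` is the extreme equivalence of `G`, and `νᵢ₊₁` relates `a` and `b` iff their
`νᵢ`-classes are related by the extreme equivalence of the quotient `G/νᵢ`. -/
def RadSeq {V : Type*} (E : V → V → Prop) : ℕ → (V → V → Prop)
  | 0 => ExtremeEq E
  | (i + 1) => fun a b => RadSeq E i a b ∨ ExtremeEq (SatEdge E (RadSeq E i)) a b

/-- The radical equivalence `ν = ⋃ᵢ νᵢ`. -/
def Radical {V : Type*} (E : V → V → Prop) : V → V → Prop :=
  fun a b => ∃ i : ℕ, RadSeq E i a b

open Classical in
/-- The value of `t` at the tuple equal to `a` on `S` and to `u` off `S`. -/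
noncomputable def mix {V : Type*} {n : ℕ} (t : (Fin n → V) → V) (S : Set (Fin n)) (a u : V) : V :=
  t fun j => if j ∈ S then a else u

/-- An idempotent polymorphism of a reflexive digraph, satisfying for each `i` an identity
`t (x on L, y off L) = t (x on R, y off R)` with `L` strictly above `i` and `i ∈ R`. -/
structure IsTriangular {V : Type*} (E : V → V → Prop) {n : ℕ} (t : (Fin n → V) → V) :
    Prop where
  refl : ∀ v, E v v
  poly : IsPoly E t
  idem : IsIdem t
  ident : ∀ i : Fin n, ∃ L R : Set (Fin n), (∀ j ∈ L, i < j) ∧ i ∈ R ∧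
    ∀ x y : V, mix t L x y = mix t R x y

theorem IsHobbyMcKenzie.isTriangular {V : Type*} {E : V → V → Prop} {n : ℕ}
    {t : (Fin n → V) → V} (hrefl : ∀ v, E v v) (hpoly : IsPoly E t)
    (h : IsHobbyMcKenzie t) : IsTriangular E t := by
  obtain ⟨hid, L, R, hL, hR, hLR, -⟩ := h
  refine ⟨hrefl, hpoly, hid, fun i => ⟨{j | L i j = true}, {j | R i j = true}, ?_, hR i, ?_⟩⟩
  · intro j hj
    by_contra hlt
    have hf := hL i j (not_lt.mp hlt)
    simp_all
  · intro x y
    convert hLR i y x using 2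
    · refine congrArg t (funext fun j => ?_)
      cases hj : L i j <;> simp [hj]
    · refine congrArg t (funext fun j => ?_)
      cases hj : R i j <;> simp [hj]

section Basic

variable {V : Type*} {E : V → V → Prop} {n : ℕ} {t : (Fin n → V) → V}

theorem SymStep.symm {u v : V} (h : SymStep E u v) : SymStep E v u := ⟨h.2, h.1⟩

theorem ExtremeEq.symm {u v : V} (h : ExtremeEq E u v) : ExtremeEq E v u := by
  induction h with
  | refl => exact Relation.ReflTransGen.refl
  | tail _ hs ih => exact Relation.ReflTransGen.head hs.symm ih

theorem ExtremeEq.trans {u v w : V} (h : ExtremeEq E u v) (h' : ExtremeEq E v w) :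
    ExtremeEq E u w :=
  Relation.ReflTransGen.trans h h'

theorem ExtremeEq.of_edges {u v : V} (h : E u v) (h' : E v u) : ExtremeEq E u v :=
  Relation.ReflTransGen.single ⟨h, h'⟩

theorem IsTriangular.edge_left (ht : IsTriangular E t) {a : V} {f : Fin n → V}
    (h : ∀ j, E a (f j)) : E a (t f) := by
  have := ht.poly (fun _ => a) f h
  rwa [ht.idem] at this

theorem IsTriangular.edge_right (ht : IsTriangular E t) {a : V} {f : Fin n → V}
    (h : ∀ j, E (f j) a) : E (t f) a := by
  have := ht.poly f (fun _ => a) h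
  rwa [ht.idem] at this

theorem IsTriangular.symStep (ht : IsTriangular E t) {f g : Fin n → V}
    (h : ∀ j, SymStep E (f j) (g j)) : SymStep E (t f) (t g) :=
  ⟨ht.poly _ _ fun j => (h j).1, ht.poly _ _ fun j => (h j).2⟩

theorem IsTriangular.extremeEq (ht : IsTriangular E t) {f g : Fin n → V}
    (h : ∀ j, ExtremeEq E (f j) (g j)) : ExtremeEq E (t f) (t g) := by
  classical
  have key : ∀ s : Finset (Fin n), ExtremeEq E (t f) (t (s.piecewise g f)) := by
    intro s
    induction s using Finset.induction_on with
    | empty =>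
      rw [Finset.piecewise_empty]
      exact Relation.ReflTransGen.refl
    | insert i s hi ih =>
      refine ih.trans ?_
      have hstep : ∀ u v, SymStep E u v →
          SymStep E (t (Function.update (s.piecewise g f) i u))
            (t (Function.update (s.piecewise g f) i v)) := by
        intro u v huv
        refine ht.symStep fun j => ?_
        by_cases hj : j = i
        · subst hj
          simpa using huv
        · simpa [hj] using ⟨ht.refl _, ht.refl _⟩
      have := Relation.ReflTransGen.lift
        (fun v => t (Function.update (s.piecewise g f) i v)) hstep _ _ (h i)
      have hfi : Function.update (s.piecewise g f) i (f i) = s.piecewise g f := by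
        rw [Function.update_eq_self_iff]
        simp [hi]
      rw [Finset.piecewise_insert]
      simpa only [Function.onFun, hfi, ExtremeEq] using this
  simpa using key Finset.univ

open Classical in
/-- The value of `t` at the tuple equal to `a` on `Q`, to `c` on `R \ Q`, and to `u`
elsewhere. -/
noncomputable def mix₃ (t : (Fin n → V) → V) (Q R : Set (Fin n)) (a c u : V) : V :=
  t fun j => if j ∈ Q then a else if j ∈ R then c else u

theorem mix₃_self (Q R : Set (Fin n)) (a u : V) :
    mix₃ t Q R a a u = mix t (R ∪ Q) a u := by
  unfold mix₃ mix
  congr 1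
  funext j
  by_cases hQ : j ∈ Q <;> by_cases hR : j ∈ R <;> simp [hQ, hR]

theorem IsTriangular.mix_eq_left (ht : IsTriangular E t) {S : Set (Fin n)}
    (hS : ∀ j, j ∈ S) (a u : V) : mix t S a u = a := by
  simpa [mix, hS] using ht.idem a

theorem IsTriangular.mix_eq_right (ht : IsTriangular E t) {S : Set (Fin n)}
    (hS : ∀ j, j ∉ S) (a u : V) : mix t S a u = u := by
  simpa [mix, hS] using ht.idem u

theorem IsTriangular.mix_eq_self (ht : IsTriangular E t) (S : Set (Fin n)) (a : V) :
    mix t S a a = a := by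
  simpa [mix] using ht.idem a

theorem IsTriangular.edge_mix (ht : IsTriangular E t) {S : Set (Fin n)} {a u v : V}
    (ha : E v a) (hu : E v u) : E v (mix t S a u) :=
  ht.edge_left fun j => by split_ifs <;> assumption

theorem IsTriangular.mix_edge (ht : IsTriangular E t) {S : Set (Fin n)} {a u v : V}
    (ha : E a v) (hu : E u v) : E (mix t S a u) v :=
  ht.edge_right fun j => by split_ifs <;> assumption

/-- `mix` respects edges, also when the set shrinks, provided `a` has an edge to the new value. -/
theorem IsTriangular.mix_edge_mix (ht : IsTriangular E t) {S T : Set (Fin n)}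
    {a a' u u' : V} (hTS : T ⊆ S) (ha : E a a') (hu : E u u') (hau : E a u') :
    E (mix t S a u) (mix t T a' u') :=
  ht.poly _ _ fun j => by
    by_cases hT : j ∈ T
    · simpa [hT, hTS hT] using ha
    · by_cases hS : j ∈ S <;> simpa [hT, hS]

theorem IsTriangular.mix_symStep (ht : IsTriangular E t) {S : Set (Fin n)}
    {a a' u u' : V} (ha : SymStep E a a') (hu : SymStep E u u') :
    SymStep E (mix t S a u) (mix t S a' u') :=
  ht.symStep fun j => by split_ifs <;> assumption

theorem IsTriangular.mix_edge_mix_same (ht : IsTriangular E t) {S : Set (Fin n)}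
    {a a' u u' : V} (ha : E a a') (hu : E u u') : E (mix t S a u) (mix t S a' u') :=
  ht.poly _ _ fun j => by split_ifs <;> assumption

theorem IsTriangular.mix₃_edge_mix₃ (ht : IsTriangular E t) {Q R : Set (Fin n)}
    {a a' c c' u u' : V} (ha : E a a') (hc : E c c') (hu : E u u') :
    E (mix₃ t Q R a c u) (mix₃ t Q R a' c' u') :=
  ht.poly _ _ fun j => by split_ifs <;> assumption

theorem IsTriangular.mix_edge_mix₃ (ht : IsTriangular E t) {Q R : Set (Fin n)}
    {a a' c' u u' : V} (ha : E a a') (hc : E u c') (hu : E u u') :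
    E (mix t Q a u) (mix₃ t Q R a' c' u') :=
  ht.poly _ _ fun j => by split_ifs <;> assumption

theorem IsTriangular.mix₃_edge_mix (ht : IsTriangular E t) {Q R : Set (Fin n)}
    {a c d x : V} (had : E a d) (hcd : E c d) (hax : E a x) :
    E (mix₃ t Q R a c x) (mix t R d x) :=
  ht.poly _ _ fun j => by
    by_cases hQ : j ∈ Q <;> by_cases hR : j ∈ R <;> simp [hQ, hR, had, hcd, hax, ht.refl]

/-- `b` has an edge to the end of a symmetric path of length `m` which starts at `a` and
consists of out-neighbours of `a`. -/
def EdgeToPath (E : V → V → Prop) (m : ℕ) (a b : V) : Prop :=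
  ∃ e : ℕ → V, e 0 = a ∧ (∀ j, SymStep E (e j) (e (j + 1))) ∧ (∀ j, E a (e j)) ∧ E b (e m)

theorem IsTriangular.edgeToPath (ht : IsTriangular E t) {m : ℕ} {a : V} {f : Fin n → V}
    (h : ∀ j, EdgeToPath E m a (f j)) : EdgeToPath E m a (t f) := by
  choose e h0 hs ha hm using h
  refine ⟨fun k => t fun j => e j k, ?_, fun k => ht.symStep fun j => hs j k,
    fun k => ht.edge_left fun j => ha j k, ht.poly _ _ hm⟩
  simpa [h0] using ht.idem a

theorem IsTriangular.edgeToPath_refl (ht : IsTriangular E t) (m : ℕ) (a : V) :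
    EdgeToPath E m a a :=
  ⟨fun _ => a, rfl, fun _ => ⟨ht.refl a, ht.refl a⟩, fun _ => ht.refl a, ht.refl a⟩

theorem IsTriangular.edgeToPath_path (ht : IsTriangular E t) {m : ℕ} {a : V} {e : ℕ → V}
    (h0 : e 0 = a) (hs : ∀ j, SymStep E (e j) (e (j + 1))) (ha : ∀ j, E a (e j)) {k : ℕ}
    (hk : k ≤ m) : EdgeToPath E m a (e k) := by
  refine ⟨fun j => e (min j k), by simpa using h0, fun j => ?_, fun j => ha _, ?_⟩
  · dsimp only
    rcases lt_or_ge j k with h | h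
    · rw [min_eq_left h.le, min_eq_left (Nat.succ_le_of_lt h)]
      exact hs j
    · rw [min_eq_right h, min_eq_right (h.trans (Nat.le_succ j))]
      exact ⟨ht.refl _, ht.refl _⟩
  · dsimp only
    rw [min_eq_right hk]
    exact ht.refl _

end Basic

section Triangle

variable {V : Type*} {E : V → V → Prop} {n : ℕ} {t : (Fin n → V) → V}

/-- A vertex between `a` and a short symmetric path from `a` can be replaced, within its
class, by one which is absorbing for the maps `u ↦ mix t T a u` with `T` contained in a
final segment. -/
theorem IsTriangular.exists_absorbing (ht : IsTriangular E t) {m : ℕ}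
    (hm : ∀ a b : V, E a b → EdgeToPath E m a b → ExtremeEq E a b) {k : ℕ} (hk : k ≤ n) :
    ∀ a b : V, E a b → EdgeToPath E (m + 1) a b →
      ∃ u, E a u ∧ EdgeToPath E (m + 1) a u ∧ ExtremeEq E b u ∧
        ∀ T : Set (Fin n), (∀ j ∈ T, k ≤ j.val) → E u (mix t T a u) := by
  induction hk using Nat.decreasingInduction with
  | self =>
    intro a b hab hP
    refine ⟨b, hab, hP, Relation.ReflTransGen.refl, fun T hT => ?_⟩
    rw [ht.mix_eq_right fun j hj => absurd (hT j hj) (not_le.mpr j.isLt)]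
    exact ht.refl b
  | of_succ k hk ih =>
    intro a b hab hP
    obtain ⟨b₀, hab₀, hPb₀, hbb₀, habs⟩ := ih a b hab hP
    obtain ⟨L, R, hL, hR, hLR⟩ := ht.ident ⟨k, hk⟩
    set Q : Set (Fin n) := {j | k + 1 ≤ j.val} with hQ
    have hLQ : L ⊆ Q := fun j hj => Nat.succ_le_of_lt (hL j hj)
    obtain ⟨e, he0, hes, hae, hb₀e⟩ := id hPb₀
    set x := mix t Q a b₀ with hx
    have hb₀x : E b₀ x := habs Q fun j hj => hj
    have hxb₀ : E x b₀ := ht.mix_edge hab₀ (ht.refl b₀)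
    have hax : E a x := ht.edge_mix (ht.refl a) hab₀
    have hPx : EdgeToPath E (m + 1) a x :=
      ht.edgeToPath fun j => by
        split_ifs
        exacts [ht.edgeToPath_refl _ a, hPb₀]
    -- the path from `x` through the vertices `mix t R (e j) x`
    have hxp : ∀ j, E x (mix t R (e j) x) := fun j => by
      rw [← hLR]
      exact ht.mix_edge_mix hLQ (hae j) hb₀x hax
    have hpx : E (mix t R (e 0) x) x := by
      rw [he0]
      exact ht.mix_edge hax (ht.refl x)
    have hps : ∀ j, SymStep E (mix t R (e j) x) (mix t R (e (j + 1)) x) := fun j =>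
      ht.mix_symStep (hes j) ⟨ht.refl x, ht.refl x⟩
    set z := mix₃ t Q R a (e (m + 1)) x with hz
    have hxz : E x z := ht.mix_edge_mix₃ (ht.refl a) hb₀e hb₀x
    have hzp : E z (mix t R (e m) x) := ht.mix₃_edge_mix (hae m) (hes m).2 hax
    have hPxz : EdgeToPath E (m + 1) x z := by
      refine ⟨fun j => Nat.casesOn j x fun j => mix t R (e j) x, rfl, ?_, ?_, hzp⟩
      · rintro (_ | j)
        · exact ⟨hxp 0, hpx⟩
        · exact hps j
      · rintro (_ | j)
        · exact ht.refl x
        · exact hxp j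
    have hzw : ExtremeEq E z (mix t R x z) := by
      obtain ⟨u, hxu, -, hzu, hu⟩ := ih x z hxz hPxz
      have huL := hu L fun j hj => hLQ hj
      rw [← hLR]
      refine (hzu.trans (.of_edges huL (ht.mix_edge hxu (ht.refl u)))).trans ?_
      refine ht.extremeEq fun j => ?_
      split_ifs
      exacts [Relation.ReflTransGen.refl, hzu.symm]
    have hpw : ExtremeEq E (mix t R a x) (mix t R x z) := by
      refine hm _ _ (ht.mix_edge_mix_same hax hxz)
        ⟨fun j => mix t R (mix t R a x) (mix t R (e j) x), ?_, fun j => ?_, fun j => ?_, ?_⟩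
      · simp only [he0]
        exact ht.mix_eq_self _ _
      · exact ht.mix_symStep ⟨ht.refl _, ht.refl _⟩ (hps j)
      · exact ht.edge_mix (ht.refl _) (ht.mix_edge_mix_same (hae j) (ht.refl x))
      · refine ht.mix_edge_mix_same ?_ hzp
        have := hxp 0
        rwa [he0] at this
    have hxz_eq : ExtremeEq E x z := by
      have h0 := ExtremeEq.of_edges (hxp 0) hpx
      rw [he0] at h0
      exact (h0.trans hpw).trans hzw.symm
    -- descend along the path `e` to reach an absorbing vertex
    let u : ℕ → V := fun s => Nat.rec x (fun s v => mix₃ t Q R a (e (m + 1 - s)) v) s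
    have hu_succ : ∀ s, u (s + 1) = mix₃ t Q R a (e (m + 1 - s)) (u s) := fun _ => rfl
    have hau : ∀ s, E a (u s) := by
      intro s
      induction s with
      | zero => exact hax
      | succ s ihs =>
        rw [hu_succ]
        exact ht.edge_left fun j => by
          split_ifs
          exacts [ht.refl a, hae _, ihs]
    have hPu : ∀ s, EdgeToPath E (m + 1) a (u s) := by
      intro s
      induction s with
      | zero => exact hPx
      | succ s ihs =>
        rw [hu_succ]
        exact ht.edgeToPath fun j => by
          split_ifs
          exacts [ht.edgeToPath_refl _ a,
            ht.edgeToPath_path he0 hes hae (Nat.sub_le _ _), ihs]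
    have hxu : ∀ s, ExtremeEq E x (u s) := by
      have hae' : ∀ s, ExtremeEq E a (e s) := by
        intro s
        induction s with
        | zero => rw [he0]; exact Relation.ReflTransGen.refl
        | succ s ihs => exact Relation.ReflTransGen.tail ihs (hes s)
      intro s
      induction s with
      | zero => exact Relation.ReflTransGen.refl
      | succ s ihs =>
        rw [hu_succ]
        refine hxz_eq.trans (ht.extremeEq fun j => ?_)
        split_ifs
        exacts [Relation.ReflTransGen.refl, (hae' _).symm.trans (hae' _), ihs]
    have huu : ∀ s, E (u s) (u (s + 1)) := by
      intro s
      induction s with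
      | zero => exact hxz
      | succ s ihs =>
        rw [hu_succ, hu_succ (s + 1)]
        refine ht.mix₃_edge_mix₃ (ht.refl a) ?_ ihs
        rcases Nat.eq_zero_or_pos (m + 1 - s) with h | h
        · rw [h, show m + 1 - (s + 1) = 0 by omega]
          exact ht.refl _
        · rw [show m + 1 - s = m + 1 - (s + 1) + 1 by omega]
          exact (hes _).2
    have hvh : u (m + 2) = mix t (R ∪ Q) a (u (m + 1)) := by
      rw [hu_succ, Nat.sub_self, he0, mix₃_self]
    refine ⟨u (m + 2), hau (m + 2), hPu (m + 2), ?_, fun T hT => ?_⟩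
    · exact (hbb₀.trans (.of_edges hb₀x hxb₀)).trans (hxu (m + 2))
    · have hsub : T ⊆ R ∪ Q := fun j hj => by
        rcases (hT j hj).eq_or_lt with h | h
        · left
          rwa [show j = ⟨k, hk⟩ from Fin.ext h.symm]
        · exact Or.inr h
      have := ht.mix_edge_mix hsub (ht.refl a) (huu (m + 1)) (hau (m + 2))
      rwa [← hvh] at this

theorem IsTriangular.extremeEq_of_edgeToPath (ht : IsTriangular E t) (m : ℕ) :
    ∀ a b : V, E a b → EdgeToPath E m a b → ExtremeEq E a b := by
  induction m with
  | zero =>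
    rintro a b hab ⟨e, he0, -, -, hb⟩
    rw [he0] at hb
    exact .of_edges hab hb
  | succ m ih =>
    intro a b hab hP
    obtain ⟨u, hau, -, hbu, hu⟩ := ht.exists_absorbing ih (Nat.zero_le n) a b hab hP
    have hua := hu Set.univ fun j _ => Nat.zero_le _
    rw [ht.mix_eq_left fun j => Set.mem_univ j] at hua
    exact (ExtremeEq.of_edges hau hua).trans hbu.symm

/-- There is a symmetric path from `a` to `c` consisting of out-neighbours of `a`. -/
def OutLinked (E : V → V → Prop) (a : V) : V → Prop :=
  Relation.ReflTransGen (fun u v => SymStep E u v ∧ E a v) a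

theorem OutLinked.extremeEq {a c : V} (h : OutLinked E a c) : ExtremeEq E a c :=
  Relation.ReflTransGen.mono (fun _ _ h => h.1) _ _ h

theorem OutLinked.edgeToPath (hrefl : ∀ v, E v v) {a c : V} (h : OutLinked E a c) :
    ∃ (m : ℕ) (e : ℕ → V), e 0 = a ∧ (∀ j, SymStep E (e j) (e (j + 1))) ∧
      (∀ j, E a (e j)) ∧ ∀ j, m ≤ j → e j = c := by
  induction h with
  | refl =>
    exact ⟨0, fun _ => a, rfl, fun _ => ⟨hrefl a, hrefl a⟩, fun _ => hrefl a, fun _ _ => rfl⟩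
  | @tail u v _ huv ih =>
    obtain ⟨m, e, h0, hs, ha, hm⟩ := ih
    refine ⟨m + 1, fun j => if j ≤ m then e j else v, by simpa using h0, fun j => ?_,
      fun j => ?_, fun j hj => if_neg (by omega)⟩
    · rcases lt_trichotomy j m with h | h | h
      · simpa [h.le, Nat.succ_le_of_lt h] using hs j
      · subst h
        simpa [hm j le_rfl] using huv.1
      · simpa [h.not_ge, (h.trans (Nat.lt_succ_self j)).not_ge] using ⟨hrefl v, hrefl v⟩
    · dsimp only
      split_ifs
      exacts [ha j, huv.2]

theorem IsTriangular.outLinked (ht : IsTriangular E t) {a b c : V} (hab : E a b)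
    (hbc : E b c) (h : OutLinked E a c) : OutLinked E a b := by
  obtain ⟨m, e, h0, hs, ha, hm⟩ := h.edgeToPath ht.refl
  let t' : (Fin n → {v // E a v}) → {v // E a v} :=
    fun f => ⟨t fun j => (f j).1, ht.edge_left fun j => (f j).2⟩
  have ht' : IsTriangular (fun u v : {v // E a v} => E u.1 v.1) t' := by
    refine ⟨fun v => ht.refl v.1, fun f g hfg => ht.poly _ _ hfg,
      fun x => Subtype.ext (ht.idem x.1), fun i => ?_⟩
    obtain ⟨L, R, hL, hR, hLR⟩ := ht.ident i
    refine ⟨L, R, hL, hR, fun x y => Subtype.ext ?_⟩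
    have key : ∀ S : Set (Fin n), (mix t' S x y).1 = mix t S x.1 y.1 := fun S => by
      refine congrArg t (funext fun j => ?_)
      by_cases hj : j ∈ S <;> simp [hj]
    rw [key, key]
    exact hLR x.1 y.1
  have hlink := ht'.extremeEq_of_edgeToPath m ⟨a, ht.refl a⟩ ⟨b, hab⟩ hab
    ⟨fun j => ⟨e j, ha j⟩, Subtype.ext h0, hs, ha, by
      change E b (e m)
      rwa [hm m le_rfl]⟩
  exact Relation.ReflTransGen.lift Subtype.val (fun _ v huv => ⟨huv, v.2⟩) _ _ hlink

theorem OutLinked.of_symStep {a c : V} (h : SymStep E a c) : OutLinked E a c :=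
  Relation.ReflTransGen.single ⟨h, h.1⟩

end Triangle

section Square

variable {V : Type*} {E : V → V → Prop} {n : ℕ} {t : (Fin n → V) → V}

theorem IsTriangular.exists_square (ht : IsTriangular E t) {a a' b b' : V} (hab : E a b)
    (hbb' : SymStep E b b') (hba' : E b' a') (haa' : SymStep E a a') {k : ℕ} (hk : k ≤ n) :
    ∃ (Q : Set (Fin n)) (u u' : V), (∀ j : Fin n, k ≤ j.val → j ∈ Q) ∧ E a u ∧
      SymStep E u u' ∧ E u' a' ∧ ExtremeEq E b u ∧ E u' (mix t Q a u) := by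
  induction hk using Nat.decreasingInduction with
  | self =>
    refine ⟨∅, b, b', fun j hj => absurd hj (not_le.mpr j.isLt), hab, hbb', hba',
      Relation.ReflTransGen.refl, ?_⟩
    rw [ht.mix_eq_right fun j => Set.notMem_empty j]
    exact hbb'.2
  | of_succ k hk ih =>
    obtain ⟨Q, u, u', hQ, hau, huu', hua', hbu, hux⟩ := ih
    obtain ⟨L, R, hL, hR, hLR⟩ := ht.ident ⟨k, hk⟩
    have hLQ : L ⊆ Q := fun j hj => hQ j (Nat.succ_le_of_lt (hL j hj))
    set x := mix t Q a u with hx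
    set p := mix t Q a u' with hp
    have hax : E a x := ht.edge_mix (ht.refl a) hau
    have hxu : E x u := ht.mix_edge hau (ht.refl u)
    have hpa' : E p a' := ht.mix_edge haa'.1 hua'
    have hpx : SymStep E p x := ht.mix_symStep ⟨ht.refl a, ht.refl a⟩ huu'.symm
    set z := mix₃ t Q R a a' x with hz
    have hpz : E p z := ht.mix_edge_mix₃ (ht.refl a) hua' hux
    have hzv : E z (mix t R a x) := ht.mix₃_edge_mix (ht.refl a) haa'.2 hax
    have hpv : E p (mix t R a x) := by
      rw [← hLR]
      exact ht.mix_edge_mix hLQ (ht.refl a) hux hax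
    have hvx : E (mix t R a x) x := ht.mix_edge hax (ht.refl x)
    have hpz_eq : ExtremeEq E p z :=
      (ht.outLinked hpz hzv (ht.outLinked hpv hvx (.of_symStep hpx))).extremeEq
    have hux_eq : ExtremeEq E u' x :=
      (ht.outLinked hux hxu (.of_symStep huu'.symm)).extremeEq
    refine ⟨R ∪ Q, z, mix₃ t Q R a a' p, fun j hj => ?_, ?_, ?_, ?_, ?_, ?_⟩
    · rcases hj.eq_or_lt with h | h
      · left
        rwa [show j = ⟨k, hk⟩ from Fin.ext h.symm]
      · exact Or.inr (hQ j h)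
    · exact ht.edge_left fun j => by
        split_ifs
        exacts [ht.refl a, haa'.1, hax]
    · exact ⟨ht.mix₃_edge_mix₃ (ht.refl a) (ht.refl a') hpx.2,
        ht.mix₃_edge_mix₃ (ht.refl a) (ht.refl a') hpx.1⟩
    · exact ht.edge_right fun j => by
        split_ifs
        exacts [haa'.1, ht.refl a', hpa']
    · exact ((hbu.trans (.of_edges huu'.1 huu'.2)).trans hux_eq).trans
        ((ExtremeEq.of_edges hpx.2 hpx.1).trans hpz_eq)
    · rw [← mix₃_self]
      exact ht.mix₃_edge_mix₃ (ht.refl a) haa'.2 hpz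

theorem IsTriangular.extremeEq_of_square (ht : IsTriangular E t) {a a' b b' : V}
    (hab : E a b) (hbb' : SymStep E b b') (hba' : E b' a') (haa' : SymStep E a a') :
    ExtremeEq E a b := by
  obtain ⟨Q, u, u', hQ, hau, huu', -, hbu, hu⟩ :=
    ht.exists_square hab hbb' hba' haa' (Nat.zero_le n)
  rw [ht.mix_eq_left fun j => hQ j (Nat.zero_le _)] at hu
  have hua := (ht.outLinked hu hau (.of_symStep huu'.symm)).extremeEq
  exact (hua.symm.trans (.of_edges huu'.2 huu'.1)).trans hbu.symm

/-- The composite of the edge relation with the symmetric edges. -/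
def EdgeThenSym (E : V → V → Prop) (u v : V) : Prop := ∃ w, E u w ∧ SymStep E w v

theorem IsTriangular.edgeThenSym (ht : IsTriangular E t) :
    IsTriangular (EdgeThenSym E) t := by
  refine ⟨fun v => ⟨v, ht.refl v, ht.refl v, ht.refl v⟩, fun f g h => ?_, ht.idem, ht.ident⟩
  choose w h₁ h₂ using h
  exact ⟨t w, ht.poly _ _ h₁, ht.symStep h₂⟩

theorem IsTriangular.extremeEq_of_symStep_edgeThenSym (ht : IsTriangular E t) {u v : V}
    (h : SymStep (EdgeThenSym E) u v) : ExtremeEq E u v := by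
  obtain ⟨⟨w, huw, hwv⟩, w', hvw', hw'u⟩ := h
  exact (ht.extremeEq_of_square huw hwv hvw' hw'u.symm).trans (.of_edges hwv.1 hwv.2)

/-- `F` is a compatible extension of `E` without new identifications. -/
def IsTameExtension (t : (Fin n → V) → V) (E F : V → V → Prop) : Prop :=
  IsTriangular F t ∧ (∀ u v, E u v → F u v) ∧ ∀ u v, SymStep F u v → ExtremeEq E u v

theorem IsTameExtension.exists_edge {F : V → V → Prop} (hF : IsTameExtension t E F)
    {a b c : V} (hab : F a b) (hbc : ExtremeEq E b c) :
    ∃ F', IsTameExtension t E F' ∧ (∀ u v, F u v → F' u v) ∧ F' a c := by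
  induction hbc with
  | refl => exact ⟨F, hF, fun _ _ h => h, hab⟩
  | @tail c d _ hcd ih =>
    obtain ⟨G, ⟨hG, hEG, hsym⟩, hFG, hac⟩ := ih
    have hle : ∀ u v, G u v → EdgeThenSym G u v := fun u v h =>
      ⟨v, h, hG.refl v, hG.refl v⟩
    refine ⟨EdgeThenSym G, ⟨hG.edgeThenSym, fun u v h => hle u v (hEG u v h),
      fun u v h => ?_⟩, fun u v h => hle u v (hFG u v h),
      c, hac, hEG _ _ hcd.1, hEG _ _ hcd.2⟩
    have huv := hG.extremeEq_of_symStep_edgeThenSym h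
    clear h
    induction huv with
    | refl => exact Relation.ReflTransGen.refl
    | tail _ hstep ih' => exact ExtremeEq.trans ih' (hsym _ _ hstep)

theorem IsTriangular.extremeEq_of_symStep_satEdge (ht : IsTriangular E t) {a b : V}
    (h : SymStep (SatEdge E (ExtremeEq E)) a b) : ExtremeEq E a b := by
  obtain ⟨⟨a₁, b₁, ha₁, hb₁, h₁⟩, b₂, a₂, hb₂, ha₂, h₂⟩ := h
  have hE : IsTameExtension t E E :=
    ⟨ht, fun _ _ h => h, fun _ _ h => Relation.ReflTransGen.single h⟩
  obtain ⟨F, hF, hEF, hab⟩ := hE.exists_edge h₁ (hb₁.symm.trans hb₂)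
  obtain ⟨G, hG, hFG, hba⟩ := hF.exists_edge (hEF _ _ h₂) (ha₂.symm.trans ha₁)
  exact (ha₁.trans (hG.2.2 _ _ ⟨hFG _ _ hab, hba⟩)).trans hb₂.symm

theorem IsTriangular.radSeq_eq (ht : IsTriangular E t) (i : ℕ) :
    RadSeq E i = ExtremeEq E := by
  induction i with
  | zero => rfl
  | succ i ih =>
    funext a b
    refine propext ⟨?_, fun h => Or.inl (by rwa [ih])⟩
    rintro (h | h)
    · rwa [ih] at h
    · rw [ih] at h
      induction h with
      | refl => exact Relation.ReflTransGen.refl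
      | tail _ hstep ih' => exact ih'.trans (ht.extremeEq_of_symStep_satEdge hstep)

end Square

/-- If a reflexive digraph admits a Hobby–McKenzie polymorphism, then its radical
equivalence coincides with its extreme equivalence. -/
theorem radical_eq_extremeEq_of_hobbyMcKenzie {V : Type*} (E : V → V → Prop)
    (hrefl : ∀ v, E v v) {n : ℕ} (t : (Fin n → V) → V)
    (hpoly : IsPoly E t) (hHM : IsHobbyMcKenzie t) :
    ∀ a b : V, Radical E a b ↔ ExtremeEq E a b := by
  have ht := hHM.isTriangular hrefl hpoly
  refine fun a b => ⟨?_, fun h => ⟨0, h⟩⟩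
  rintro ⟨i, h⟩
  rwa [ht.radSeq_eq i] at h

end DigraphHM1
end

section
/- Let G be a reflexive digraph admitting a Hobby–McKenzie polymorphism. Then the K-equivalence of G coincides with the extreme equivalence of G; equivalently, every K-component of G is extremely connected. -/
namespace DigraphHM2

/-- `f` is a polymorphism of the digraph `(V, E)`. -/
def IsPoly {V : Type*} (E : V → V → Prop) {n : ℕ} (f : (Fin n → V) → V) : Prop :=
  ∀ a b : Fin n → V, (∀ i, E (a i) (b i)) → E (f a) (f b)

/-- `f` is idempotent. -/
def IsIdem {V : Type*} {n : ℕ} (f : (Fin n → V) → V) : Prop :=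
  ∀ x : V, f (fun _ => x) = x

/-- `t` is a Hobby–McKenzie operation: it is idempotent and for each `i` it satisfies a
linear identity in two variables `x, y` whose left side has `x` in the first `i+1`
coordinates and whose right side has `y` in coordinate `i` (the other coordinates being
arbitrary choices of `x` or `y`, encoded by the boolean matrices `L` and `R`), such that
no operation `a ↦ min_{k ∈ I} a k` (for nonempty `I`) on the two-element chain
`false < true` satisfies all `n` of these identities. -/
def IsHobbyMcKenzie {V : Type*} {n : ℕ} (t : (Fin n → V) → V) : Prop :=
  IsIdem t ∧
  ∃ L R : Fin n → Fin n → Bool,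
    (∀ i j : Fin n, j ≤ i → L i j = false) ∧
    (∀ i : Fin n, R i i = true) ∧
    (∀ i : Fin n, ∀ x y : V,
      t (fun j => cond (L i j) y x) = t (fun j => cond (R i j) y x)) ∧
    ¬ ∃ I : Finset (Fin n), I.Nonempty ∧
        ∀ i : Fin n, ∀ x y : Bool,
          decide (∀ k ∈ I, cond (L i k) y x = true) =
          decide (∀ k ∈ I, cond (R i k) y x = true)

/-- One step of a symmetric path: edges in both directions. -/
def SymStep {V : Type*} (E : V → V → Prop) : V → V → Prop :=
  fun u v => E u v ∧ E v u

/-- The extreme equivalence: being connected by a symmetric path. -/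
def ExtremeEq {V : Type*} (E : V → V → Prop) : V → V → Prop :=
  Relation.ReflTransGen (SymStep E)

/-- `φ` is a digraph homomorphism from `(W, EH)` to `(V, EG)`. -/
def IsHom {W V : Type*} (EH : W → W → Prop) (EG : V → V → Prop) (φ : W → V) : Prop :=
  ∀ u v : W, EH u v → EG (φ u) (φ v)

/-- The `H`-equivalence of `G`: the equivalence relation generated by the relation
holding between `g` and `g'` whenever they both lie in the range of a homomorphism
from `H` to `G`. -/
def HEqv {W V : Type*} (EH : W → W → Prop) (EG : V → V → Prop) : V → V → Prop :=
  Relation.EqvGen (fun g g' =>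
    ∃ φ : W → V, IsHom EH EG φ ∧ (∃ u, φ u = g) ∧ (∃ v, φ v = g'))

/-- The reflexive digraph `K` on `{0,1,2,3}` with non-loop edges
`0 → 1`, `1 → 0`, `1 → 2`, `2 → 3`, `3 → 2`, `3 → 0`. -/
def KEdge : Fin 4 → Fin 4 → Prop := fun a b =>
  a = b ∨ (a = 0 ∧ b = 1) ∨ (a = 1 ∧ b = 0) ∨ (a = 1 ∧ b = 2) ∨
    (a = 2 ∧ b = 3) ∨ (a = 3 ∧ b = 2) ∨ (a = 3 ∧ b = 0)

theorem IsPoly.edge_to {V : Type*} {E : V → V → Prop} {n : ℕ} {t : (Fin n → V) → V}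
    (hpoly : IsPoly E t) (hid : IsIdem t) {f : Fin n → V} {c : V} (h : ∀ j, E (f j) c) :
    E (t f) c := by
  have h' := hpoly f (fun _ => c) h
  rwa [hid c] at h'

theorem IsPoly.edge_from {V : Type*} {E : V → V → Prop} {n : ℕ} {t : (Fin n → V) → V}
    (hpoly : IsPoly E t) (hid : IsIdem t) {f : Fin n → V} {c : V} (h : ∀ j, E c (f j)) :
    E c (t f) := by
  have h' := hpoly (fun _ => c) f h
  rwa [hid c] at h'

theorem IsPoly.symStep {V : Type*} {E : V → V → Prop} {n : ℕ} {t : (Fin n → V) → V}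
    (hpoly : IsPoly E t) : IsPoly (SymStep E) t :=
  fun f g h => ⟨hpoly f g fun j => (h j).1, hpoly g f fun j => (h j).2⟩

theorem isPoly_eq {V : Type*} {n : ℕ} (t : (Fin n → V) → V) : IsPoly (Eq : V → V → Prop) t :=
  fun _ _ h => congrArg t (funext h)

theorem SymStep.symm {V : Type*} {E : V → V → Prop} {u v : V} (h : SymStep E u v) :
    SymStep E v u :=
  ⟨h.2, h.1⟩

theorem SymStep.extremeEq {V : Type*} {E : V → V → Prop} {u v : V} (h : SymStep E u v) :
    ExtremeEq E u v :=
  .single h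

theorem ExtremeEq.symm {V : Type*} {E : V → V → Prop} {u v : V} (h : ExtremeEq E u v) :
    ExtremeEq E v u := by
  induction h with
  | refl => exact .refl
  | tail _ hstep ih => exact ih.head hstep.symm

theorem ExtremeEq.trans {V : Type*} {E : V → V → Prop} {u v w : V} (huv : ExtremeEq E u v)
    (hvw : ExtremeEq E v w) : ExtremeEq E u w :=
  Relation.ReflTransGen.trans huv hvw

/-- Let `B` be a reflexive compatible relation inside the symmetric part of `E` such that every
closed walk `x B y → z → x` stays in one extreme component. Then so does every closed walk
`a B b → c ↔ d → a`. The proof shows, by downward induction on `k`, that replacing by `c` any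
arguments of `t` with index at least `k` in the constant tuple `a` does not change the extreme
component of the value. -/
theorem extremeEq_of_closed_walk {V : Type*} {E B : V → V → Prop} (hrefl : ∀ v, E v v)
    {n : ℕ} {t : (Fin n → V) → V} (hpoly : IsPoly E t) (hid : IsIdem t)
    {L R : Fin n → Fin n → Bool} (hL : ∀ i j : Fin n, j ≤ i → L i j = false)
    (hR : ∀ i : Fin n, R i i = true)
    (hLR : ∀ i : Fin n, ∀ x y : V,
      t (fun j => cond (L i j) y x) = t (fun j => cond (R i j) y x))
    (hBrefl : ∀ v, B v v) (hBpoly : IsPoly B t) (hBE : ∀ u v, B u v → SymStep E u v)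
    (hB : ∀ x y z, B x y → E y z → E z x → ExtremeEq E x z)
    {a b c d : V} (hab : B a b) (hbc : E b c) (hcd : SymStep E c d) (hda : E d a) :
    ExtremeEq E a c := by
  have key : ∀ k, k ≤ n → ∀ (u : Fin n → Bool), (∀ j : Fin n, (j : ℕ) < k → u j = false) →
      ∀ a b c d : V, B a b → E b c → SymStep E c d → E d a →
        ExtremeEq E a (t fun j => cond (u j) c a) := by
    intro k hk
    induction hk using Nat.decreasingInduction with
    | self =>
      intro u hu a b c d _ _ _ _
      have h : (fun j => cond (u j) c a) = fun _ => a := by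
        funext j
        rw [hu j j.2, cond_false]
      rw [h, hid a]
      exact .refl
    | of_succ k hk ih =>
      intro u hu a b c d hab hbc hcd hda
      let i : Fin n := ⟨k, hk⟩
      have hS : ∀ v, SymStep E v v := fun v => ⟨hrefl v, hrefl v⟩
      have hba : E b a := (hBE a b hab).2
      let w : Fin n → Bool := fun j => if j = i then false else u j
      let f : V → V := fun x => t fun j => cond (w j) c x
      let q : V → V := fun x => t fun j => cond (u j) (if j = i then c else d) x
      let e : V → V := fun x => t fun j => cond (L i j) c (f x)
      have hw : ∀ j : Fin n, (j : ℕ) < k + 1 → w j = false := by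
        intro j hj
        by_cases h : j = i
        · simp [w, h]
        · have : (j : ℕ) ≠ k := fun h' => h (Fin.ext h')
          simp [w, h, hu j (by omega)]
      have hLi : ∀ j : Fin n, (j : ℕ) < k + 1 → L i j = false := fun j hj =>
        hL i j (Fin.le_def.2 (Nat.lt_succ_iff.1 hj))
      have hfB : B (f a) (f b) := hBpoly _ _ fun j => by
        cases w j
        · exact hab
        · exact hBrefl c
      have hqB : B (q a) (q b) := hBpoly _ _ fun j => by
        cases u j
        · exact hab
        · exact hBrefl _
      have heB : B (e a) (e b) := hBpoly _ _ fun j => by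
        cases L i j
        · exact hfB
        · exact hBrefl c
      have hfc : E (f b) c := hpoly.edge_to hid fun j => by
        cases w j
        · exact hbc
        · exact hrefl c
      have hdf : E d (f a) := hpoly.edge_from hid fun j => by
        cases w j
        · exact hda
        · exact hcd.2
      have hbf : E b (f a) := hpoly.edge_from hid fun j => by
        cases w j
        · exact hba
        · exact hbc
      have hqc : E (q b) c := hpoly.edge_to hid fun j => by
        cases u j
        · exact hbc
        · dsimp only [cond_true]
          split_ifs
          · exact hrefl c
          · exact hcd.2
      have hdq : E d (q a) := hpoly.edge_from hid fun j => by
        cases u j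
        · exact hda
        · dsimp only [cond_true]
          split_ifs
          · exact hcd.2
          · exact hrefl d
      have hfq : E (f b) (q b) := hpoly _ _ fun j => by
        by_cases h : j = i <;> cases hj : u j <;> simp [w, h, hj, hrefl, hbc, hcd.1]
      have hqe : E (q b) (e a) := by
        simp only [e, hLR i]
        refine hpoly _ _ fun j => ?_
        by_cases h : j = i
        · rw [h, hR i]
          cases u i
          · exact hbc
          · simpa using hrefl c
        · cases u j <;> cases R i j <;> simp [h, hbf, hbc, hdf, hcd.2]
      have hde : E d (e a) := hpoly.edge_from hid fun j => by
        cases L i j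
        · exact hdf
        · exact hcd.2
      have hloop : ExtremeEq E (e a) (t fun j => cond (L i j) d (q b)) := by
        refine hB (e a) (e b) _ heB (hpoly _ _ fun j => ?_) (hpoly.edge_to hid fun j => ?_)
        · cases L i j
          · exact hfq
          · exact hcd.1
        · cases L i j
          · exact hqe
          · exact hde
      have hswap : SymStep E (t fun j => cond (L i j) d (q b))
          (t fun j => cond (L i j) c (q a)) := hpoly.symStep _ _ fun j => by
        cases L i j
        · exact (hBE _ _ hqB).symm
        · exact hcd.symm
      have hend : SymStep E (q a) (t fun j => cond (u j) c a) := hpoly.symStep _ _ fun j => by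
        cases u j
        · exact hS a
        · dsimp only [cond_true]
          split_ifs
          · exact hS c
          · exact hcd.symm
      exact (ih w hw a b c d hab hbc hcd hda).trans <|
        (ih (L i) hLi (f a) (f b) c d hfB hfc hcd hdf).trans <|
        hloop.trans <| hswap.extremeEq.trans <|
        (ih (L i) hLi (q a) (q b) c d hqB hqc hcd hdq).symm.trans hend.extremeEq
  have h := key 0 n.zero_le (fun _ => true) (fun j hj => absurd hj (Nat.not_lt_zero _))
    a b c d hab hbc hcd hda
  simpa only [cond_true, hid c] using h

/-- If a reflexive digraph admits a Hobby–McKenzie polymorphism, then its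
`K`-equivalence coincides with its extreme equivalence. -/
theorem kEqv_eq_extremeEq_of_hobbyMcKenzie {V : Type*} (E : V → V → Prop)
    (hrefl : ∀ v, E v v) {n : ℕ} (t : (Fin n → V) → V)
    (hpoly : IsPoly E t) (hHM : IsHobbyMcKenzie t) :
    ∀ a b : V, HEqv KEdge E a b ↔ ExtremeEq E a b := by
  obtain ⟨hid, L, R, hL, hR, hLR, -⟩ := hHM
  have triangle : ∀ x y z, SymStep E x y → E y z → E z x → ExtremeEq E x z :=
    fun x y z hxy hyz hzx => ExtremeEq.symm <|
      extremeEq_of_closed_walk hrefl hpoly hid hL hR hLR (fun _ => rfl) (isPoly_eq t)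
        (fun u v huv => huv ▸ ⟨hrefl u, hrefl u⟩)
        (fun p q r hpq hqr hrp => SymStep.extremeEq ⟨hpq ▸ hqr, hrp⟩)
        (rfl : z = z) hzx hxy hyz
  intro a b
  constructor
  · intro h
    induction h with
    | refl x => exact .refl
    | symm x y _ ih => exact ih.symm
    | trans x y z _ _ ih ih' => exact ih.trans ih'
    | rel x y h =>
      obtain ⟨φ, hφ, ⟨p, rfl⟩, ⟨q, rfl⟩⟩ := h
      have h01 : SymStep E (φ 0) (φ 1) :=
        ⟨hφ 0 1 (by simp [KEdge]), hφ 1 0 (by simp [KEdge])⟩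
      have h23 : SymStep E (φ 2) (φ 3) :=
        ⟨hφ 2 3 (by simp [KEdge]), hφ 3 2 (by simp [KEdge])⟩
      have h02 : ExtremeEq E (φ 0) (φ 2) :=
        extremeEq_of_closed_walk hrefl hpoly hid hL hR hLR (fun v => ⟨hrefl v, hrefl v⟩)
          hpoly.symStep (fun _ _ h => h) triangle h01 (hφ 1 2 (by simp [KEdge])) h23
          (hφ 3 0 (by simp [KEdge]))
      have h0 : ∀ r, ExtremeEq E (φ 0) (φ r) := by
        intro r
        fin_cases r
        · exact .refl
        · exact h01.extremeEq
        · exact h02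
        · exact h02.trans h23.extremeEq
      exact (h0 p).symm.trans (h0 q)
  · intro h
    induction h with
    | refl => exact .refl _
    | @tail x y _ hxy ih =>
      refine .trans _ _ _ ih (.rel _ _ ⟨fun r => if r = 0 then x else y, ?_, ⟨0, by simp⟩,
        ⟨1, by simp⟩⟩)
      intro r s _
      dsimp only
      split_ifs
      · exact hrefl x
      · exact hxy.1
      · exact hxy.2
      · exact hrefl y

end DigraphHM2
end

section
/- Let G be a reflexive digraph admitting a Hobby–McKenzie polymorphism. Then there exist a positive integer n and 6-ary polymorphisms s₁,…,sₙ and t₁,…,tₙ of G such that for all vertices x, y, z: t₁(x,x,y,y,z,z) = x; tᵢ(x,x,y,y,z,z) = sᵢ(x,y,y,z,z,x) for all 1 ≤ i ≤ n; sᵢ(x,x,y,y,z,z) = tᵢ(x,y,y,z,z,x) for all 1 ≤ i ≤ n; tᵢ(x,x,y,y,z,z) = tᵢ₋₁(x,y,y,z,z,x) for all 1 < i ≤ n; and tₙ(x,y,y,z,z,x) = y. -/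
namespace DigraphHM3

/-- `f` is a polymorphism of the digraph `(V, E)`. -/
def IsPoly {V : Type*} (E : V → V → Prop) {n : ℕ} (f : (Fin n → V) → V) : Prop :=
  ∀ a b : Fin n → V, (∀ i, E (a i) (b i)) → E (f a) (f b)

/-- `f` is idempotent. -/
def IsIdem {V : Type*} {n : ℕ} (f : (Fin n → V) → V) : Prop :=
  ∀ x : V, f (fun _ => x) = x

/-- `t` is a Hobby–McKenzie operation: it is idempotent and for each `i` it satisfies a
linear identity in two variables `x, y` whose left side has `x` in the first `i+1`
coordinates and whose right side has `y` in coordinate `i` (the other coordinates being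
arbitrary choices of `x` or `y`, encoded by the boolean matrices `L` and `R`), such that
no operation `a ↦ min_{k ∈ I} a k` (for nonempty `I`) on the two-element chain
`false < true` satisfies all `n` of these identities. -/
def IsHobbyMcKenzie {V : Type*} {n : ℕ} (t : (Fin n → V) → V) : Prop :=
  IsIdem t ∧
  ∃ L R : Fin n → Fin n → Bool,
    (∀ i j : Fin n, j ≤ i → L i j = false) ∧
    (∀ i : Fin n, R i i = true) ∧
    (∀ i : Fin n, ∀ x y : V,
      t (fun j => cond (L i j) y x) = t (fun j => cond (R i j) y x)) ∧
    ¬ ∃ I : Finset (Fin n), I.Nonempty ∧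
        ∀ i : Fin n, ∀ x y : Bool,
          decide (∀ k ∈ I, cond (L i k) y x = true) =
          decide (∀ k ∈ I, cond (R i k) y x = true)

/-- `M` is idempotent and preserves every reflexive relation preserved by `t`; the ternary
operations obtained from an idempotent `t` by identifying variables have this property. -/
def IsTernaryMinor {α : Type*} {n : ℕ} (t : (Fin n → α) → α) (M : α → α → α → α) : Prop :=
  (∀ a, M a a a = a) ∧
    ∀ r : α → α → Prop, IsPoly r t → ∀ {a a' b b' c c' : α},
      r a a' → r b b' → r c c' → r (M a b c) (M a' b' c')

lemma isTernaryMinor_ite {α : Type*} {n : ℕ} {t : (Fin n → α) → α} (ht : IsIdem t)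
    (A B : Fin n → Bool) :
    IsTernaryMinor t (fun p q r => t (fun j => bif A j then p else bif B j then q else r)) := by
  refine ⟨fun a => ?_, fun r hr a a' b b' c c' ha hb hc => hr _ _ fun j => ?_⟩
  · simpa using ht a
  · cases A j <;> cases B j <;> assumption

/-- Induction over the coordinates of a Hobby–McKenzie operation. -/
lemma of_matrix_identities {n : ℕ} {L R : Fin n → Fin n → Bool}
    (hL : ∀ i j : Fin n, j ≤ i → L i j = false) (hR : ∀ i : Fin n, R i i = true)
    (J : (Fin n → Bool) → Prop) (bot : J fun _ => false) (step : ∀ i, J (L i) → J (R i))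
    (down : ∀ A B : Fin n → Bool, (∀ j, A j = true → B j = true) → J B → J A)
    (union : ∀ A B : Fin n → Bool, (∀ j, A j = true → B j = false) → J A → J B →
      J fun j => A j || B j) :
    J fun _ => true := by
  have key : ∀ k : ℕ, J fun j => decide (n ≤ j + k) := by
    intro k
    induction k with
    | zero =>
      refine down _ _ (fun j hj => ?_) bot
      have := j.isLt
      simp at hj
      omega
    | succ k ih =>
      by_cases hk : k < n
      · have hi : n - 1 - k < n := by omega
        let i : Fin n := ⟨n - 1 - k, hi⟩
        have h1 : J (L i) := by
          refine down _ _ (fun j hj => ?_) ih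
          by_contra hlt
          have : j ≤ i := by
            rw [Fin.le_def]
            simp only [decide_eq_true_eq] at hlt
            simp only [i]
            omega
          rw [hL i j this] at hj
          exact Bool.noConfusion hj
        have h2 : J fun j => decide (j = i) :=
          down _ _ (fun j hj => by rw [of_decide_eq_true hj]; exact hR i) (step i h1)
        refine down _ _ ?above (union _ _ ?disjoint h2 ih)
        case disjoint =>
          intro j hj
          simp only [decide_eq_true_eq, decide_eq_false_iff_not] at hj ⊢
          subst hj
          simp only [i]
          omega
        case above =>
          intro j hj
          simp only [decide_eq_true_eq, Bool.or_eq_true, Fin.ext_iff, i] at hj ⊢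
          omega
      · refine down _ _ (fun j _ => ?_) ih
        simp only [decide_eq_true_eq]
        omega
  refine down _ _ (fun j _ => ?_) (key n)
  simp

lemma subset_of_ternaryMinor_closed {α : Type*} {n : ℕ} {t : (Fin n → α) → α}
    (ht : IsHobbyMcKenzie t) (U S : Set α) {v : α} (hv : v ∈ S)
    (down : ∀ M, IsTernaryMinor t M → (∀ u ∈ U, M u u v ∈ S) → ∀ u ∈ U, M u v v ∈ S)
    (union : ∀ M, IsTernaryMinor t M → (∀ u ∈ U, M u v v ∈ S) → (∀ u ∈ U, M v u v ∈ S) →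
      ∀ u ∈ U, M u u v ∈ S) : U ⊆ S := by
  obtain ⟨hid, L, R, hL, hR, hLR, -⟩ := ht
  have h := of_matrix_identities hL hR
    (fun A => ∀ u ∈ U, t (fun j => bif A j then u else v) ∈ S)
    (fun u _ => by simpa [hid v] using hv)
    (fun i h u hu => by rw [← hLR i v u]; exact h u hu)
    (fun A B hAB hB u hu => by
      have := down _ (isTernaryMinor_ite hid A B) (fun u hu => by
        convert hB u hu using 3 with j
        have := hAB j
        revert this
        cases A j <;> cases B j <;> simp) u hu
      convert this using 3 with j
      cases A j <;> cases B j <;> rfl)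
    (fun A B hAB hA hB u hu => by
      have := union _ (isTernaryMinor_ite hid A B)
        (fun u hu => by
          convert hA u hu using 3 with j
          cases A j <;> cases B j <;> rfl)
        (fun u hu => by
          convert hB u hu using 3 with j
          have := hAB j
          revert this
          cases A j <;> cases B j <;> simp) u hu
      convert this using 3 with j
      dsimp only
      cases A j <;> cases B j <;> rfl)
  intro u hu
  simpa [hid u] using h u hu

section Congruence

variable {α : Type*} {n : ℕ} {t : (Fin n → α) → α} {E θ : α → α → Prop}

/-- The case `b = d` of `rel_of_four_cycle`. -/
lemma rel_of_between (ht : IsHobbyMcKenzie t) (hrefl : ∀ a, E a a) (hE : IsPoly E t)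
    (hθ : Equivalence θ) (hθt : IsPoly θ t) (hT : ∀ a b, E a b → E b a → θ a b)
    {p q b : α} (hpq : E p q) (hqp : E q p) (hpb : E p b) (hbq : E b q) : θ p b := by
  have hpq' := hT _ _ hpq hqp
  refine subset_of_ternaryMinor_closed ht {p} {x | θ x b} (hθ.refl b) ?_ ?_ rfl
  · rintro M ⟨hM, hMr⟩ h u rfl
    have hg : θ (M u u b) b := h u rfl
    have h1 : θ (M u b b) (M q (M u u b) (M u u b)) :=
      hMr θ hθt hpq' (hθ.symm hg) (hθ.symm hg)
    have hgq : E (M u u b) q := by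
      simpa only [hM] using hMr E hE hpq hpq hbq
    have hgb : E (M u u b) b := by
      simpa only [hM] using hMr E hE hpb hpb (hrefl b)
    have hqw : E (M u q b) q := by
      simpa only [hM] using hMr E hE hpq (hrefl q) hbq
    have hwg : E (M u q b) (M u u b) := hMr E hE (hrefl u) hqp (hrefl b)
    have h2 : θ (M q (M u u b) (M u u b)) (M u q b) := by
      refine hT _ _ (hMr E hE hqp hgq hgb) ?_
      simpa only [hM] using hMr E hE hqw hwg hwg
    have h3 : θ (M u q b) (M u u b) :=
      hMr θ hθt (hθ.refl _) (hθ.symm hpq') (hθ.refl _)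
    exact hθ.trans h1 (hθ.trans h2 (hθ.trans h3 hg))
  · rintro M ⟨hM, hMr⟩ h h' u rfl
    have hβ : θ (M b q b) b :=
      hθ.trans (hMr θ hθt (hθ.refl _) (hθ.symm hpq') (hθ.refl _)) (h' u rfl)
    have h1 : θ (M u u b) (M q u b) := hMr θ hθt hpq' (hθ.refl _) (hθ.refl _)
    have hbβ : E b (M b q b) := by
      simpa only [hM] using hMr E hE (hrefl b) hbq (hrefl b)
    have huβ : E u (M b q b) := by
      simpa only [hM] using hMr E hE hpb hpq hpb
    have huv : E u (M q u b) := by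
      simpa only [hM] using hMr E hE hpq (hrefl u) hpb
    have hβv : E (M b q b) (M q u b) := hMr E hE hbq hqp (hrefl b)
    have h2 : θ (M q u b) (M u (M b q b) (M b q b)) := by
      refine hT _ _ (hMr E hE hqp huβ hbβ) ?_
      simpa only [hM] using hMr E hE huv hβv hβv
    have h3 : θ (M u (M b q b) (M b q b)) (M u b b) := hMr θ hθt (hθ.refl _) hβ hβ
    exact hθ.trans h1 (hθ.trans h2 (hθ.trans h3 (h u rfl)))

lemma rel_of_four_cycle (ht : IsHobbyMcKenzie t) (hrefl : ∀ a, E a a) (hE : IsPoly E t)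
    (hθ : Equivalence θ) (hθt : IsPoly θ t) (hT : ∀ a b, E a b → E b a → θ a b)
    {p q b d : α} (hpq : E p q) (hqp : E q p) (hqb : E q b) (hbd : E b d) (hdb : E d b)
    (hdp : E d p) : θ p b := by
  have hpq' := hT _ _ hpq hqp
  have hbd' := hT _ _ hbd hdb
  have between {a a' r : α} (h1 : E a a') (h2 : E a' a) (h3 : E a r) (h4 : E r a') : θ a r :=
    rel_of_between ht hrefl hE hθ hθt hT h1 h2 h3 h4
  refine subset_of_ternaryMinor_closed ht {p} {x | θ x b} (hθ.refl b) ?_ ?_ rfl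
  · rintro M ⟨hM, hMr⟩ h u rfl
    have hg : θ (M u u b) b := h u rfl
    have hg1 : θ (M u u d) b :=
      hθ.trans (hMr θ hθt (hθ.refl _) (hθ.refl _) (hθ.symm hbd')) hg
    have hg2 : θ (M q q b) b :=
      hθ.trans (hMr θ hθt (hθ.symm hpq') (hθ.symm hpq') (hθ.refl _)) hg
    have hau : E (M q u d) u := by
      simpa only [hM] using hMr E hE hqp (hrefl u) hdp
    have has : E (M q u d) (M u (M u u d) (M q q b)) := by
      have h1 : E (M q u d) (M u u d) := hMr E hE hqp (hrefl u) (hrefl d)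
      have h2 : E (M q u d) (M q q b) := hMr E hE (hrefl q) hpq hdb
      simpa only [hM] using hMr E hE hau h1 h2
    have hsa : E (M u (M u u d) (M q q b)) (M u u b) := by
      have h1 : E (M u u d) u := by
        simpa only [hM] using hMr E hE (hrefl u) (hrefl u) hdp
      have h2 : E (M q q b) b := by
        simpa only [hM] using hMr E hE hqb hqb (hrefl b)
      exact hMr E hE (hrefl u) h1 h2
    have h1 : θ (M q u d) (M u (M u u d) (M q q b)) :=
      between (hMr E hE hqp (hrefl u) hdb) (hMr E hE hpq (hrefl u) hbd) has hsa
    have h2 : θ (M q u d) (M u u b) := hMr θ hθt (hθ.symm hpq') (hθ.refl _) (hθ.symm hbd')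
    have h3 : θ (M u b b) (M u (M u u d) (M q q b)) :=
      hMr θ hθt (hθ.refl _) (hθ.symm hg1) (hθ.symm hg2)
    exact hθ.trans h3 (hθ.trans (hθ.symm h1) (hθ.trans h2 hg))
  · rintro M ⟨hM, hMr⟩ h h' u rfl
    have hb0 : θ (M u b b) b := h u rfl
    have hb1 : θ (M q d d) b :=
      hθ.trans (hMr θ hθt (hθ.symm hpq') (hθ.symm hbd') (hθ.symm hbd')) hb0
    have hcp : E (M q d d) u := by
      simpa only [hM] using hMr E hE hqp hdp hdp
    have hcb : E (M q d d) b := by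
      simpa only [hM] using hMr E hE hqb hdb hdb
    have hwp : E (M u q (M q d d)) u := by
      simpa only [hM] using hMr E hE (hrefl u) hqp hcp
    have hwb : E (M u q (M q d d)) (M u b b) := hMr E hE (hrefl u) hqb hcb
    have hwa : E (M u q (M q d d)) (M (M u b b) u (M u b b)) := by
      simpa only [hM] using hMr E hE hwb hwp hwb
    have haw : E (M (M q d d) u (M q d d)) (M u q (M q d d)) := hMr E hE hcp hpq (hrefl _)
    have hcc : E (M q d d) (M u b b) := hMr E hE hqp hdb hdb
    have hcc' : E (M u b b) (M q d d) := hMr E hE hpq hbd hbd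
    have h1 : θ (M (M q d d) u (M q d d)) (M u q (M q d d)) :=
      between (hMr E hE hcc (hrefl u) hcc) (hMr E hE hcc' (hrefl u) hcc') haw hwa
    have h2 : θ (M (M q d d) u (M q d d)) (M b u b) := hMr θ hθt hb1 (hθ.refl _) hb1
    have h3 : θ (M u u b) (M u q (M q d d)) := hMr θ hθt (hθ.refl _) hpq' (hθ.symm hb1)
    exact hθ.trans h3 (hθ.trans (hθ.symm h1) (hθ.trans h2 (h' u rfl)))


/-- The digraphs `E ∘ T ∘ ⋯ ∘ T`, where at each stage `T` is the symmetric part of the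
digraph reached so far. -/
def symmExtend (E : α → α → Prop) : ℕ → α → α → Prop
  | 0 => E
  | k + 1 => fun a c => ∃ b, symmExtend E k a b ∧ symmExtend E k b c ∧ symmExtend E k c b

lemma symmExtend_refl (hrefl : ∀ a, E a a) (k : ℕ) (a : α) : symmExtend E k a a := by
  induction k with
  | zero => exact hrefl a
  | succ k ih => exact ⟨a, ih, ih, ih⟩

lemma symmExtend_succ (hrefl : ∀ a, E a a) {k : ℕ} {a b : α} (h : symmExtend E k a b) :
    symmExtend E (k + 1) a b :=
  ⟨b, h, symmExtend_refl hrefl k b, symmExtend_refl hrefl k b⟩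

lemma symmExtend_of_rel (hrefl : ∀ a, E a a) (k : ℕ) {a b : α} (h : E a b) :
    symmExtend E k a b := by
  induction k with
  | zero => exact h
  | succ k ih => exact symmExtend_succ hrefl ih

lemma isPoly_symmExtend (hE : IsPoly E t) (k : ℕ) : IsPoly (symmExtend E k) t := by
  induction k with
  | zero => exact hE
  | succ k ih =>
    intro a c h
    choose b hb using h
    exact ⟨t b, ih _ _ fun i => (hb i).1, ih _ _ fun i => (hb i).2.1,
      ih _ _ fun i => (hb i).2.2⟩

lemma rel_of_symmExtend (ht : IsHobbyMcKenzie t) (hrefl : ∀ a, E a a) (hE : IsPoly E t)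
    (hθ : Equivalence θ) (hθt : IsPoly θ t) (hT : ∀ a b, E a b → E b a → θ a b) (k : ℕ) :
    ∀ a b, symmExtend E k a b → symmExtend E k b a → θ a b := by
  induction k with
  | zero => exact hT
  | succ k ih =>
    rintro a b ⟨c, hac, hcb, hbc⟩ ⟨d, hbd, hda, had⟩
    exact hθ.trans (ih _ _ had hda) (hθ.trans (rel_of_four_cycle ht (symmExtend_refl hrefl k)
      (isPoly_symmExtend hE k) hθ hθt ih hda had hac hcb hbc hbd) (ih _ _ hcb hbc))

end Congruence

/-- The symmetric part of `E`. -/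
def SymmPart {α : Type*} (E : α → α → Prop) (a b : α) : Prop := E a b ∧ E b a

section SymmPart

open Relation

variable {α : Type*} {n : ℕ} {t : (Fin n → α) → α} {E : α → α → Prop}

lemma isPoly_reflTransGen {r : α → α → Prop} (hr : ∀ a, r a a) (h : IsPoly r t) :
    IsPoly (ReflTransGen r) t := by
  intro a b hab
  have key : ∀ s : Finset (Fin n), ReflTransGen r (t a) (t (s.piecewise b a)) := by
    intro s
    induction s using Finset.induction_on with
    | empty => rw [Finset.piecewise_empty]
    | insert i s hi ih =>
      refine ih.trans ?_
      have h1 := (hab i).lift (fun x => t (Function.update (s.piecewise b a) i x))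
        (p := r) fun x y hxy => h _ _ fun j => by
          by_cases hj : j = i
          · subst hj; simpa using hxy
          · simpa [hj] using hr _
      rw [Finset.piecewise_insert]
      convert h1 using 2
      refine (Function.update_eq_self_iff.2 ?_).symm
      simp [hi]
  simpa using key Finset.univ

lemma equivalence_reflTransGen_symmPart : Equivalence (ReflTransGen (SymmPart E)) :=
  ⟨fun _ => .refl, fun h => by
    have : Std.Symm (SymmPart E) := ⟨fun _ _ h => ⟨h.2, h.1⟩⟩
    exact ReflTransGen.stdSymm.symm _ _ h,
    fun h h' => h.trans h'⟩

lemma isPoly_reflTransGen_symmPart (hrefl : ∀ a, E a a) (hE : IsPoly E t) :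
    IsPoly (ReflTransGen (SymmPart E)) t :=
  isPoly_reflTransGen (fun a => ⟨hrefl a, hrefl a⟩) fun _ _ h =>
    ⟨hE _ _ fun i => (h i).1, hE _ _ fun i => (h i).2⟩

/-- The classes of `ReflTransGen (SymmPart E)` are convex. -/
lemma reflTransGen_symmPart_of_between (ht : IsHobbyMcKenzie t) (hrefl : ∀ a, E a a)
    (hE : IsPoly E t) {a b c : α} (hab : E a b) (hbc : E b c)
    (hca : ReflTransGen (SymmPart E) c a) : ReflTransGen (SymmPart E) b a := by
  have key : ∃ k, symmExtend E k b a := by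
    clear hab
    induction hca with
    | refl => exact ⟨0, hbc⟩
    | tail _ h ih =>
      obtain ⟨k, hk⟩ := ih
      exact ⟨k + 1, _, hk, symmExtend_of_rel hrefl k h.1, symmExtend_of_rel hrefl k h.2⟩
  obtain ⟨k, hk⟩ := key
  exact rel_of_symmExtend ht hrefl hE equivalence_reflTransGen_symmPart
    (isPoly_reflTransGen_symmPart hrefl hE) (fun _ _ h h' => .single ⟨h, h'⟩) k b a hk
    (symmExtend_of_rel hrefl k hab)

lemma reflTransGen_symmPart_of_three_cycle (ht : IsHobbyMcKenzie t) (hrefl : ∀ a, E a a)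
    (hE : IsPoly E t) {x y z : α} (hxy : E x y) (hyz : E y z) (hzx : E z x) :
    ReflTransGen (SymmPart E) x y := by
  have hθ : Equivalence (ReflTransGen (SymmPart E)) := equivalence_reflTransGen_symmPart
  have convex {a b c : α} (ha : ReflTransGen (SymmPart E) a x) (hab : E a b) (hbc : E b c)
      (hc : ReflTransGen (SymmPart E) c x) : ReflTransGen (SymmPart E) b x :=
    (reflTransGen_symmPart_of_between ht hrefl hE hab hbc (hc.trans (hθ.symm ha))).trans ha
  refine hθ.symm (subset_of_ternaryMinor_closed ht {y, z}
    {a | ReflTransGen (SymmPart E) a x} (hθ.refl x) ?_ ?_ (Set.mem_insert y {z}))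
  · rintro M ⟨hM, hMr⟩ h
    have hy : ReflTransGen (SymmPart E) (M y y x) x := h y (by simp)
    have hz : ReflTransGen (SymmPart E) (M z z x) x := h z (by simp)
    have hx : ReflTransGen (SymmPart E) (M x x x) x := by rw [hM]
    rintro u (rfl | rfl)
    · exact convex hx (hMr E hE hxy (hrefl _) (hrefl _)) (hMr E hE (hrefl _) hxy (hrefl _)) hy
    · exact convex hz (hMr E hE (hrefl _) hzx (hrefl _)) (hMr E hE hzx (hrefl _) (hrefl _)) hx
  · rintro M ⟨hM, hMr⟩ h h'
    have hy : ReflTransGen (SymmPart E) (M y x x) x := h y (by simp)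
    have hz : ReflTransGen (SymmPart E) (M z x x) x := h z (by simp)
    have hy' : ReflTransGen (SymmPart E) (M x y x) x := h' y (by simp)
    have hz' : ReflTransGen (SymmPart E) (M x z x) x := h' z (by simp)
    have hzy : ReflTransGen (SymmPart E) (M z y x) x :=
      convex hz (hMr E hE (hrefl _) hxy (hrefl _)) (hMr E hE hzx hyz (hrefl _)) hz'
    rintro u (rfl | rfl)
    · exact convex hy' (hMr E hE hxy (hrefl _) (hrefl _))
        (hMr E hE hyz (hrefl _) (hrefl _)) hzy
    · exact convex hzy (hMr E hE (hrefl _) hyz (hrefl _))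
        (hMr E hE hzx (hrefl _) (hrefl _)) hz'

lemma exists_chain_of_reflTransGen {r : α → α → Prop} (hr : ∀ a, r a a) {a b : α}
    (h : ReflTransGen r a b) :
    ∃ n : ℕ, 0 < n ∧ ∃ w : ℕ → α, w 0 = a ∧ w n = b ∧ ∀ i < n, r (w i) (w (i + 1)) := by
  induction h with
  | refl => exact ⟨1, Nat.one_pos, fun _ => a, rfl, rfl, fun _ _ => hr a⟩
  | @tail b c _ hbc ih =>
    obtain ⟨n, hn, w, h0, hb, hw⟩ := ih
    refine ⟨n + 1, n.succ_pos, fun i => if i ≤ n then w i else c, by simp [h0], by simp,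
      fun i hi => ?_⟩
    rcases Nat.lt_succ_iff_lt_or_eq.1 hi with hi | rfl
    · simpa [hi.le, Nat.succ_le_of_lt hi] using hw i hi
    · simpa [hb] using hbc

end SymmPart

/-- The ternary polymorphisms of `E`. -/
def TernaryPoly {V : Type*} (E : V → V → Prop) : Type _ :=
  {u : (Fin 3 → V) → V // IsPoly E u}

/-- There is an edge from `u` to `v` if they arise from a single 6-ary polymorphism by the
identifications `x x y y z z` and `x y y z z x` of its variables. -/
def SixEdge {V : Type*} (E : V → V → Prop) (u v : TernaryPoly E) : Prop :=
  ∃ s : (Fin 6 → V) → V, IsPoly E s ∧ ∀ x y z : V,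
    s ![x, x, y, y, z, z] = u.1 ![x, y, z] ∧ s ![x, y, y, z, z, x] = v.1 ![x, y, z]

section Free

variable {V : Type*} {E : V → V → Prop}

lemma sixEdge_refl (u : TernaryPoly E) : SixEdge E u u := by
  refine ⟨fun a => u.1 ![a 0, a 2, a 4], fun a b h => u.2 _ _ fun i => ?_,
    fun x y z => ⟨?_, ?_⟩⟩
  · fin_cases i <;> exact h _
  · simp
  · simp

/-- The pointwise action of a polymorphism on ternary polymorphisms. -/
def pointwiseOp {m : ℕ} {t : (Fin m → V) → V} (ht : IsPoly E t)
    (a : Fin m → TernaryPoly E) : TernaryPoly E :=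
  ⟨fun p => t fun i => (a i).1 p, fun _ _ h => ht _ _ fun i => (a i).2 _ _ h⟩

lemma isPoly_pointwiseOp {m : ℕ} {t : (Fin m → V) → V} (ht : IsPoly E t) :
    IsPoly (SixEdge E) (pointwiseOp ht) := by
  intro a b h
  choose s hs hs' using h
  exact ⟨fun p => t fun i => s i p, fun _ _ h => ht _ _ fun i => hs i _ _ h,
    fun x y z => ⟨congrArg t (funext fun i => (hs' i x y z).1),
      congrArg t (funext fun i => (hs' i x y z).2)⟩⟩

lemma isHobbyMcKenzie_pointwiseOp {m : ℕ} {t : (Fin m → V) → V} (ht : IsPoly E t)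
    (hHM : IsHobbyMcKenzie t) : IsHobbyMcKenzie (pointwiseOp ht) := by
  obtain ⟨hid, L, R, hL, hR, hLR, hmin⟩ := hHM
  refine ⟨fun u => Subtype.ext (funext fun p => hid (u.1 p)), L, R, hL, hR,
    fun i u v => Subtype.ext (funext fun p => ?_), hmin⟩
  convert hLR i (u.1 p) (v.1 p) using 1
  · exact congrArg t (funext fun j => by dsimp only; cases L i j <;> rfl)
  · exact congrArg t (funext fun j => by dsimp only; cases R i j <;> rfl)

/-- The `i`-th projection. -/
def coord (E : V → V → Prop) (i : Fin 3) : TernaryPoly E := ⟨fun p => p i, fun _ _ h => h i⟩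

lemma sixEdge_coord (i : Fin 6) {j k : Fin 3}
    (h : ∀ x y z : V, ![x, x, y, y, z, z] i = ![x, y, z] j ∧
      ![x, y, y, z, z, x] i = ![x, y, z] k) : SixEdge E (coord E j) (coord E k) :=
  ⟨fun p => p i, fun _ _ hp => hp i, h⟩

end Free

/-- If a reflexive digraph admits a Hobby–McKenzie polymorphism, then it admits
6-ary polymorphisms `s₁, …, sₙ` and `t₁, …, tₙ` satisfying the chain of identities
`t₁(x,x,y,y,z,z) = x`, `tᵢ(x,x,y,y,z,z) = sᵢ(x,y,y,z,z,x)`,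
`sᵢ(x,x,y,y,z,z) = tᵢ(x,y,y,z,z,x)`, `tᵢ(x,x,y,y,z,z) = tᵢ₋₁(x,y,y,z,z,x)`
for `1 < i ≤ n`, and `tₙ(x,y,y,z,z,x) = y`. -/
theorem exists_chain_terms_of_hobbyMcKenzie {V : Type*} (E : V → V → Prop)
    (hrefl : ∀ v, E v v) {m : ℕ} (t : (Fin m → V) → V)
    (hpoly : IsPoly E t) (hHM : IsHobbyMcKenzie t) :
    ∃ n : ℕ, ∃ hn : 0 < n, ∃ s ts : Fin n → ((Fin 6 → V) → V),
      (∀ i : Fin n, IsPoly E (s i)) ∧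
      (∀ i : Fin n, IsPoly E (ts i)) ∧
      ∀ x y z : V,
        ts ⟨0, hn⟩ ![x, x, y, y, z, z] = x ∧
        (∀ i : Fin n, ts i ![x, x, y, y, z, z] = s i ![x, y, y, z, z, x]) ∧
        (∀ i : Fin n, s i ![x, x, y, y, z, z] = ts i ![x, y, y, z, z, x]) ∧
        (∀ i j : Fin n, (i : ℕ) + 1 = (j : ℕ) →
          ts j ![x, x, y, y, z, z] = ts i ![x, y, y, z, z, x]) ∧
        ts ⟨n - 1, Nat.sub_lt hn Nat.one_pos⟩ ![x, y, y, z, z, x] = y := by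
  have hpath : Relation.ReflTransGen (SymmPart (SixEdge E)) (coord E 0) (coord E 1) :=
    reflTransGen_symmPart_of_three_cycle (isHobbyMcKenzie_pointwiseOp hpoly hHM) sixEdge_refl
      (isPoly_pointwiseOp hpoly) (z := coord E 2)
      (sixEdge_coord 1 fun _ _ _ => ⟨rfl, rfl⟩) (sixEdge_coord 3 fun _ _ _ => ⟨rfl, rfl⟩)
      (sixEdge_coord 5 fun _ _ _ => ⟨rfl, rfl⟩)
  obtain ⟨n, hn, w, h0, hw, hstep⟩ :=
    exists_chain_of_reflTransGen (fun u => ⟨sixEdge_refl u, sixEdge_refl u⟩) hpath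
  choose ts hts hts' using fun i : Fin n => (hstep i i.isLt).1
  choose s hs hs' using fun i : Fin n => (hstep i i.isLt).2
  refine ⟨n, hn, s, ts, hs, hts, fun x y z => ⟨?_, fun i => ?_, fun i => ?_, fun i j hij => ?_,
    ?_⟩⟩
  · rw [(hts' _ x y z).1, h0]
    rfl
  · rw [(hts' i x y z).1, (hs' i x y z).2]
  · rw [(hs' i x y z).1, (hts' i x y z).2]
  · rw [(hts' j x y z).1, (hts' i x y z).2, hij]
  · rw [(hts' _ x y z).2, Nat.sub_add_cancel hn, hw]
    rfl

end DigraphHM3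
end

section
/- Let G be a reflexive digraph admitting, for some positive integer n, 6-ary polymorphisms s₁,…,sₙ and t₁,…,tₙ such that for all vertices x, y, z: t₁(x,x,y,y,z,z) = x; tᵢ(x,x,y,y,z,z) = sᵢ(x,y,y,z,z,x) for all 1 ≤ i ≤ n; sᵢ(x,x,y,y,z,z) = tᵢ(x,y,y,z,z,x) for all 1 ≤ i ≤ n; tᵢ(x,x,y,y,z,z) = tᵢ₋₁(x,y,y,z,z,x) for all 1 < i ≤ n; and tₙ(x,y,y,z,z,x) = y. Then the strong equivalence of G coincides with the extreme equivalence of G. -/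
namespace DigraphHM4

/-- `f` is a polymorphism of the digraph `(V, E)`. -/
def IsPoly {V : Type*} (E : V → V → Prop) {n : ℕ} (f : (Fin n → V) → V) : Prop :=
  ∀ a b : Fin n → V, (∀ i, E (a i) (b i)) → E (f a) (f b)

/-- One step of a symmetric path: edges in both directions. -/
def SymStep {V : Type*} (E : V → V → Prop) : V → V → Prop :=
  fun u v => E u v ∧ E v u

/-- The extreme equivalence: being connected by a symmetric path. -/
def ExtremeEq {V : Type*} (E : V → V → Prop) : V → V → Prop :=
  Relation.ReflTransGen (SymStep E)

/-- The strong equivalence: directed paths both ways. -/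
def StrongEq {V : Type*} (E : V → V → Prop) : V → V → Prop :=
  fun a b => Relation.ReflTransGen E a b ∧ Relation.ReflTransGen E b a

section

variable {V : Type*}

/-- A curried 6-ary operation preserves the relation `E`. -/
def Preserves (E : V → V → Prop) (g : V → V → V → V → V → V → V) : Prop :=
  ∀ ⦃a₁ a₂ a₃ a₄ a₅ a₆ b₁ b₂ b₃ b₄ b₅ b₆ : V⦄, E a₁ b₁ → E a₂ b₂ → E a₃ b₃ → E a₄ b₄ →
    E a₅ b₅ → E a₆ b₆ → E (g a₁ a₂ a₃ a₄ a₅ a₆) (g b₁ b₂ b₃ b₄ b₅ b₆)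

/-- The terms `s`, `t` in curried form, together with the ternary terms `f` interpolating
between the first and the second projection. -/
structure ChainTerms (V : Type*) (n : ℕ) where
  f : ℕ → V → V → V → V
  t : ℕ → V → V → V → V → V → V → V
  s : ℕ → V → V → V → V → V → V → V
  f_zero : ∀ x y z, f 0 x y z = x
  f_last : ∀ x y z, f n x y z = y
  t_left : ∀ i < n, ∀ x y z, t i x x y y z z = f i x y z
  t_right : ∀ i < n, ∀ x y z, t i x y y z z x = f (i + 1) x y z
  s_left : ∀ i < n, ∀ x y z, s i x y y z z x = f i x y z
  s_right : ∀ i < n, ∀ x y z, s i x x y y z z = f (i + 1) x y z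

/-- Iterated self-composition: `dbl r m` is the `2 ^ m`-fold composition of `r`. -/
def dbl (r : V → V → Prop) : ℕ → V → V → Prop
  | 0 => r
  | m + 1 => Relation.Comp (dbl r m) (dbl r m)

lemma dbl_refl {r : V → V → Prop} (hr : ∀ v, r v v) (m : ℕ) (v : V) : dbl r m v v := by
  induction m with
  | zero => exact hr v
  | succ m ih => exact ⟨v, ih, ih⟩

lemma dbl_mono {r : V → V → Prop} (hr : ∀ v, r v v) {m k : ℕ} (h : m ≤ k) {u v : V}
    (huv : dbl r m u v) : dbl r k u v := by
  induction k, h using Nat.le_induction with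
  | base => exact huv
  | succ k _ ih => exact ⟨v, ih, dbl_refl hr k v⟩

lemma exists_dbl_of_reflTransGen {r : V → V → Prop} (hr : ∀ v, r v v) {u v : V}
    (h : Relation.ReflTransGen r u v) : ∃ m, dbl r m u v := by
  induction h with
  | refl => exact ⟨0, hr u⟩
  | tail _ hbc ih =>
    obtain ⟨m, hm⟩ := ih
    exact ⟨m + 1, _, hm, dbl_mono hr (Nat.zero_le m) hbc⟩

section Symmetric

variable {E : V → V → Prop} {u v w : V}

lemma SymStep.symm (h : SymStep E u v) : SymStep E v u := ⟨h.2, h.1⟩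

lemma SymStep.extremeEq (h : SymStep E u v) : ExtremeEq E u v := .single h

lemma ExtremeEq.symm (h : ExtremeEq E u v) : ExtremeEq E v u := by
  induction h with
  | refl => exact .refl
  | tail _ hbc ih => exact .head hbc.symm ih

lemma ExtremeEq.trans (h : ExtremeEq E u v) (h' : ExtremeEq E v w) : ExtremeEq E u w :=
  Relation.ReflTransGen.trans h h'

lemma ExtremeEq.of_symStep_le {F : V → V → Prop}
    (hle : ∀ u v, SymStep F u v → ExtremeEq E u v) (h : ExtremeEq F u v) : ExtremeEq E u v := by
  induction h with
  | refl => exact .refl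
  | tail _ hbc ih => exact ih.trans (hle _ _ hbc)

end Symmetric

section Preserves

variable {E F : V → V → Prop} {g : V → V → V → V → V → V → V}

lemma Preserves.comp (hE : Preserves E g) (hF : Preserves F g) :
    Preserves (Relation.Comp E F) g := by
  rintro a₁ a₂ a₃ a₄ a₅ a₆ b₁ b₂ b₃ b₄ b₅ b₆ ⟨c₁, h₁, k₁⟩ ⟨c₂, h₂, k₂⟩ ⟨c₃, h₃, k₃⟩
    ⟨c₄, h₄, k₄⟩ ⟨c₅, h₅, k₅⟩ ⟨c₆, h₆, k₆⟩
  exact ⟨_, hE h₁ h₂ h₃ h₄ h₅ h₆, hF k₁ k₂ k₃ k₄ k₅ k₆⟩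

lemma Preserves.and (hE : Preserves E g) (hF : Preserves F g) :
    Preserves (fun u v => E u v ∧ F u v) g :=
  fun _ _ _ _ _ _ _ _ _ _ _ _ h₁ h₂ h₃ h₄ h₅ h₆ =>
    ⟨hE h₁.1 h₂.1 h₃.1 h₄.1 h₅.1 h₆.1, hF h₁.2 h₂.2 h₃.2 h₄.2 h₅.2 h₆.2⟩

lemma Preserves.symStep (hE : Preserves E g) : Preserves (SymStep E) g :=
  fun _ _ _ _ _ _ _ _ _ _ _ _ h₁ h₂ h₃ h₄ h₅ h₆ =>
    ⟨hE h₁.1 h₂.1 h₃.1 h₄.1 h₅.1 h₆.1, hE h₁.2 h₂.2 h₃.2 h₄.2 h₅.2 h₆.2⟩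

lemma Preserves.reflTransGen (hr : ∀ v, E v v) (hE : Preserves E g) :
    Preserves (Relation.ReflTransGen E) g := by
  intro a₁ a₂ a₃ a₄ a₅ a₆ b₁ b₂ b₃ b₄ b₅ b₆ h₁ h₂ h₃ h₄ h₅ h₆
  refine (h₁.lift (fun x => g x a₂ a₃ a₄ a₅ a₆) ?_).trans <|
    (h₂.lift (fun x => g b₁ x a₃ a₄ a₅ a₆) ?_).trans <|
    (h₃.lift (fun x => g b₁ b₂ x a₄ a₅ a₆) ?_).trans <|
    (h₄.lift (fun x => g b₁ b₂ b₃ x a₅ a₆) ?_).trans <|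
    (h₅.lift (fun x => g b₁ b₂ b₃ b₄ x a₆) ?_).trans <|
    h₆.lift (fun x => g b₁ b₂ b₃ b₄ b₅ x) ?_ <;>
  · intro x y hxy
    apply hE <;> first | exact hxy | exact hr _

end Preserves

/-- A reflexive relation compatible with all the chain terms. -/
structure Compatible {n : ℕ} (C : ChainTerms V n) (E : V → V → Prop) : Prop where
  refl : ∀ v, E v v
  t : ∀ i < n, Preserves E (C.t i)
  s : ∀ i < n, Preserves E (C.s i)

namespace Compatible

variable {n : ℕ} {C : ChainTerms V n} {E F : V → V → Prop}

lemma comp (hE : Compatible C E) (hF : Compatible C F) : Compatible C (Relation.Comp E F) :=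
  ⟨fun v => ⟨v, hE.refl v, hF.refl v⟩, fun i hi => (hE.t i hi).comp (hF.t i hi),
    fun i hi => (hE.s i hi).comp (hF.s i hi)⟩

lemma and (hE : Compatible C E) (hF : Compatible C F) :
    Compatible C (fun u v => E u v ∧ F u v) :=
  ⟨fun v => ⟨hE.refl v, hF.refl v⟩, fun i hi => (hE.t i hi).and (hF.t i hi),
    fun i hi => (hE.s i hi).and (hF.s i hi)⟩

lemma symStep (hE : Compatible C E) : Compatible C (SymStep E) :=
  ⟨fun v => ⟨hE.refl v, hE.refl v⟩, fun i hi => (hE.t i hi).symStep,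
    fun i hi => (hE.s i hi).symStep⟩

lemma extremeEq (hE : Compatible C E) : Compatible C (ExtremeEq E) :=
  ⟨fun _ => .refl, fun i hi => (hE.t i hi).symStep.reflTransGen hE.symStep.refl,
    fun i hi => (hE.s i hi).symStep.reflTransGen hE.symStep.refl⟩

/-- The ternary terms preserve every compatible relation. -/
lemma f_edge (hE : Compatible C E) {i : ℕ} (hi : i ≤ n) {x y z x' y' z' : V}
    (hx : E x x') (hy : E y y') (hz : E z z') : E (C.f i x y z) (C.f i x' y' z') := by
  cases i with
  | zero => simpa only [C.f_zero] using hx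
  | succ i =>
    rw [← C.t_right i hi, ← C.t_right i hi]
    exact hE.t i hi hx hy hy hz hz hx

/-- Edges from one interpolating term to the next. -/
lemma f_up (hE : Compatible C E) {i : ℕ} (hi : i < n) {x y z x' y' z' : V}
    (hxx : E x x') (hxy : E x y') (hyy : E y y') (hyz : E y z') (hzz : E z z') (hzx : E z x') :
    E (C.f i x y z) (C.f (i + 1) x' y' z') := by
  rw [← C.t_left i hi, ← C.t_right i hi]
  exact hE.t i hi hxx hxy hyy hyz hzz hzx

/-- Edges from one interpolating term to the previous one. -/
lemma f_down (hE : Compatible C E) {i : ℕ} (hi : i < n) {x y z x' y' z' : V}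
    (hxx : E x x') (hxy : E x y') (hyy : E y y') (hyz : E y z') (hzz : E z z') (hzx : E z x') :
    E (C.f (i + 1) x y z) (C.f i x' y' z') := by
  rw [← C.s_left i hi, ← C.s_right i hi]
  exact hE.s i hi hxx hxy hyy hyz hzz hzx

lemma extremeEq_of_forall (T : V × V × V)
    (h : ∀ i < n, ExtremeEq E (C.f i T.1 T.2.1 T.2.2) (C.f (i + 1) T.1 T.2.1 T.2.2)) :
    ExtremeEq E T.1 T.2.1 := by
  have key : ∀ i ≤ n, ExtremeEq E T.1 (C.f i T.1 T.2.1 T.2.2) := by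
    intro i
    induction i with
    | zero => intro _; rw [C.f_zero]; exact .refl
    | succ i ih => intro hi; exact (ih (Nat.le_of_succ_le hi)).trans (h i hi)
  simpa only [C.f_last] using key n le_rfl

/-- Directed 3-cycles lie in extreme classes. -/
lemma extremeEq_of_three_cycle (hE : Compatible C E) {x y z : V} (hxy : E x y) (hyz : E y z)
    (hzx : E z x) : ExtremeEq E x y :=
  extremeEq_of_forall (C := C) (x, y, z) fun _ hi => SymStep.extremeEq
    ⟨hE.f_up hi (hE.refl x) hxy (hE.refl y) hyz (hE.refl z) hzx,
      hE.f_down hi (hE.refl x) hxy (hE.refl y) hyz (hE.refl z) hzx⟩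

/-- A 4-cycle with two consecutive symmetric edges lies in an extreme class. -/
lemma extremeEq_of_four_cycle (hE : Compatible C E) {v p u q : V} (hvp : E v p)
    (hpu : SymStep E p u) (huq : SymStep E u q) (hqv : E q v) : ExtremeEq E v u := by
  refine extremeEq_of_forall (C := C) (v, u, q) fun i hi => ?_
  have h₁ : E (C.f i v u q) (C.f (i + 1) v p q) :=
    hE.f_up hi (hE.refl v) hvp hpu.2 huq.1 (hE.refl q) hqv
  have h₂ : E (C.f (i + 1) v p q) (C.f i v p u) :=
    hE.f_down hi (hE.refl v) hvp (hE.refl p) hpu.1 huq.2 hqv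
  have h₃ : E (C.f i v p u) (C.f i v u q) := hE.f_edge hi.le (hE.refl v) hpu.1 huq.1
  exact (hE.extremeEq_of_three_cycle h₁ h₂ h₃).trans
    (SymStep.extremeEq (hE.symStep.f_edge hi (hE.symStep.refl v) hpu (hE.symStep.refl q)))

end Compatible

/-- Enlarge `E` by the symmetric relation `r`, composed on either side. -/
def enlarge (r E : V → V → Prop) (u v : V) : Prop :=
  Relation.Comp r E u v ∧ Relation.Comp E r u v

section Enlarge

variable {n : ℕ} {C : ChainTerms V n} {r E : V → V → Prop}

lemma Compatible.enlarge (hr : Compatible C r) (hE : Compatible C E) :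
    Compatible C (enlarge r E) :=
  (hr.comp hE).and (hE.comp hr)

lemma le_enlarge (hr : ∀ v, r v v) {u v : V} (h : E u v) : enlarge r E u v :=
  ⟨⟨u, hr u, h⟩, ⟨v, h, hr v⟩⟩

lemma Compatible.extremeEq_of_enlarge (hE : Compatible C E) {u v : V}
    (h : ExtremeEq (DigraphHM4.enlarge (SymStep E) E) u v) : ExtremeEq E u v := by
  refine h.of_symStep_le fun u v huv => ?_
  obtain ⟨⟨⟨q, huq, hqv⟩, -⟩, ⟨-, ⟨p, hvp, hpu⟩⟩⟩ := huv
  exact (hE.extremeEq_of_four_cycle hvp hpu huq hqv).symm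

lemma dbl_symStep_enlarge {m : ℕ} {u v : V} (h : dbl (SymStep E) (m + 1) u v) :
    dbl (SymStep (enlarge (SymStep E) E)) m u v := by
  induction m generalizing u v with
  | zero =>
    obtain ⟨w, huw, hwv⟩ := h
    exact ⟨⟨⟨w, huw, hwv.1⟩, ⟨w, huw.1, hwv⟩⟩, ⟨⟨w, hwv.symm, huw.2⟩, ⟨w, hwv.2, huw.symm⟩⟩⟩
  | succ m ih =>
    obtain ⟨w, huw, hwv⟩ := h
    exact ⟨w, ih huw, ih hwv⟩

lemma Compatible.extremeEq_of_dbl {m : ℕ} (hE : Compatible C E) {a b c : V} (hab : E a b)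
    (hbc : E b c) (hca : dbl (SymStep E) m c a) : ExtremeEq E a b := by
  induction m generalizing E with
  | zero => exact hE.extremeEq_of_three_cycle hab hbc hca.1
  | succ m ih =>
    have hS := hE.symStep.refl
    exact hE.extremeEq_of_enlarge (ih (hE.symStep.enlarge hE) (le_enlarge hS hab)
      (le_enlarge hS hbc) (dbl_symStep_enlarge hca))

/-- Two consecutive edges whose endpoints are extremely equivalent lie in an extreme class. -/
lemma Compatible.extremeEq_of_edges (hE : Compatible C E) {a b c : V} (hab : E a b)
    (hbc : E b c) (hca : ExtremeEq E c a) : ExtremeEq E a b := by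
  obtain ⟨m, hm⟩ := exists_dbl_of_reflTransGen hE.symStep.refl hca
  exact hE.extremeEq_of_dbl hab hbc hm

lemma Compatible.symStep_enlarge_extremeEq (hE : Compatible C E) {u v : V} :
    SymStep (DigraphHM4.enlarge (ExtremeEq E) E) u v ↔ ExtremeEq E u v := by
  constructor
  · rintro ⟨⟨⟨q, huq, hqv⟩, -⟩, ⟨-, ⟨p, hvp, hpu⟩⟩⟩
    exact huq.trans (hE.extremeEq_of_edges hqv hvp (hpu.trans huq))
  · intro h
    exact ⟨⟨⟨v, h, hE.refl v⟩, ⟨u, hE.refl u, h⟩⟩,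
      ⟨⟨u, h.symm, hE.refl u⟩, ⟨v, hE.refl v, h.symm⟩⟩⟩

end Enlarge

/-- For any two elements `p` and `q` of `H`, the element `q` lies on a 2-step directed path in `H`
whose endpoints are joined to `p` by an edge. -/
def Linked (E : V → V → Prop) (H : Set V) : Prop :=
  ∀ p ∈ H, ∀ q ∈ H, ∃ r ∈ H, ∃ r' ∈ H,
    (E p r ∨ E r p) ∧ (E p r' ∨ E r' p) ∧ E r q ∧ E q r'

/-- A compatible relation whose symmetric part is transitive. -/
structure SymTransitive {n : ℕ} (C : ChainTerms V n) (E : V → V → Prop) : Prop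
    extends Compatible C E where
  trans : ∀ {u v w}, SymStep E u v → SymStep E v w → SymStep E u w

namespace SymTransitive

variable {n : ℕ} {C : ChainTerms V n} {E : V → V → Prop}

lemma symStep_of_extremeEq (hE : SymTransitive C E) {u v : V} (h : ExtremeEq E u v) :
    SymStep E u v := by
  induction h with
  | refl => exact hE.symStep.refl u
  | tail _ hbc ih => exact hE.trans ih hbc

lemma three_cycle (hE : SymTransitive C E) {x y z : V} (hxy : E x y) (hyz : E y z)
    (hzx : E z x) : SymStep E x y :=
  hE.symStep_of_extremeEq (hE.extremeEq_of_three_cycle hxy hyz hzx)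

lemma between (hE : SymTransitive C E) {x a b c : V} (hab : E a b) (hbc : E b c)
    (hax : SymStep E a x) (hcx : SymStep E c x) : SymStep E b x :=
  hE.trans (hE.three_cycle hab hbc (hE.trans hcx hax.symm).1).symm hax

lemma binary_of_diagonal (hE : SymTransitive C E) {H : Set V} (hH : Linked E H) {g : V → V → V}
    {x : V} (hg : ∀ {p q p' q'}, E p p' → E q q' → E (g p q) (g p' q'))
    (hd : ∀ p ∈ H, SymStep E (g p p) x) : ∀ p ∈ H, ∀ q ∈ H, SymStep E (g p q) x := by
  have adj : ∀ p ∈ H, ∀ q ∈ H, E p q ∨ E q p → SymStep E (g p q) x := by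
    rintro p hp q hq (h | h)
    · exact hE.between (hg (hE.refl p) h) (hg h (hE.refl q)) (hd p hp) (hd q hq)
    · exact hE.between (hg h (hE.refl q)) (hg (hE.refl p) h) (hd q hq) (hd p hp)
  intro p hp q hq
  obtain ⟨r, hr, r', hr', h, h', hrq, hqr'⟩ := hH p hp q hq
  exact hE.between (hg (hE.refl p) hrq) (hg (hE.refl p) hqr') (adj p hp r hr h)
    (adj p hp r' hr' h')

lemma f_succ_of_f (hE : SymTransitive C E) {H : Set V} (hH : Linked E H) {i : ℕ} (hi : i < n)
    (hf : ∀ x ∈ H, ∀ y ∈ H, ∀ z ∈ H, SymStep E (C.f i x y z) x) {x z : V} (hx : x ∈ H)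
    (hz : z ∈ H) :
    SymStep E (C.f (i + 1) x x z) x ∧ SymStep E (C.f (i + 1) x z x) x := by
  have hr := hE.refl
  constructor
  · rw [← C.t_right i hi]
    refine hE.binary_of_diagonal hH (g := fun p q => C.t i x x x z p q)
      (fun hp hq => hE.t i hi (hr _) (hr _) (hr _) (hr _) hp hq) (fun r hr' => ?_) z hz x hx
    refine hE.binary_of_diagonal hH (g := fun p q => C.t i x x p q r r)
      (fun hp hq => hE.t i hi (hr _) (hr _) hp hq (hr _) (hr _)) (fun p hp => ?_) x hx z hz
    simpa only [C.t_left i hi] using hf x hx p hp r hr'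
  · rw [← C.s_right i hi]
    refine hE.binary_of_diagonal hH (g := fun p q => C.s i x x z p q x)
      (fun hp hq => hE.s i hi (hr _) (hr _) (hr _) hp hq (hr _)) (fun r hr' => ?_) z hz x hx
    refine hE.binary_of_diagonal hH (g := fun p q => C.s i x p q r r x)
      (fun hp hq => hE.s i hi (hr _) hp hq (hr _) (hr _) (hr _)) (fun p hp => ?_) x hx z hz
    simpa only [C.s_left i hi] using hf x hx p hp r hr'

/-- If the property `f i x y z ~ x` on `H` propagates along the chain, `H` lies in one class. -/
lemma symStep_of_step (hE : SymTransitive C E) {H : Set V}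
    (step : ∀ i < n, (∀ x ∈ H, ∀ y ∈ H, ∀ z ∈ H, SymStep E (C.f i x y z) x) →
      ∀ x ∈ H, ∀ y ∈ H, ∀ z ∈ H, SymStep E (C.f (i + 1) x y z) x)
    {a b : V} (ha : a ∈ H) (hb : b ∈ H) : SymStep E a b := by
  have key : ∀ i ≤ n, ∀ x ∈ H, ∀ y ∈ H, ∀ z ∈ H, SymStep E (C.f i x y z) x := by
    intro i
    induction i with
    | zero => intro _ x _ y _ z _; rw [C.f_zero]; exact hE.symStep.refl x
    | succ i ih => exact fun hi => step i hi (ih (Nat.le_of_succ_le hi))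
  simpa only [C.f_last] using (key n le_rfl a ha b hb b hb).symm

lemma linked_of_two_edges (hE : SymTransitive C E) {a b c d : V} (hab : E a b)
    (hbc : SymStep E b c) (hcd : E c d) (hda : SymStep E d a) : Linked E {a, b, c, d} := by
  have hr := hE.refl
  have adj : ∀ {p q}, q ∈ ({a, b, c, d} : Set V) → E p q ∨ E q p →
      ∃ r ∈ ({a, b, c, d} : Set V), ∃ r' ∈ ({a, b, c, d} : Set V),
        (E p r ∨ E r p) ∧ (E p r' ∨ E r' p) ∧ E r q ∧ E q r' :=
    fun {_ q} hq h => ⟨q, hq, q, hq, h, h, hr q, hr q⟩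
  have ha : a ∈ ({a, b, c, d} : Set V) := by simp
  have hb : b ∈ ({a, b, c, d} : Set V) := by simp
  have hc : c ∈ ({a, b, c, d} : Set V) := by simp
  have hd : d ∈ ({a, b, c, d} : Set V) := by simp
  rintro p (rfl | rfl | rfl | rfl) q (rfl | rfl | rfl | rfl)
  exacts [
    adj ha (.inl (hr _)), adj hb (.inl hab),
    ⟨_, hb, _, hb, .inl hab, .inl hab, hbc.1, hbc.2⟩, adj hd (.inr hda.1),
    adj ha (.inr hab), adj hb (.inl (hr _)), adj hc (.inl hbc.1),
    ⟨_, ha, _, ha, .inr hab, .inr hab, hda.2, hda.1⟩,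
    ⟨_, hd, _, hd, .inl hcd, .inl hcd, hda.1, hda.2⟩, adj hb (.inr hbc.1),
    adj hc (.inl (hr _)), adj hd (.inl hcd), adj ha (.inl hda.1),
    ⟨_, hc, _, hc, .inr hcd, .inr hcd, hbc.2, hbc.1⟩, adj hc (.inr hcd),
    adj hd (.inl (hr _))]

/-- A 4-cycle with two opposite symmetric edges lies in an extreme class. -/
lemma symStep_of_two_edges (hE : SymTransitive C E) {a b c d : V} (hab : E a b)
    (hbc : SymStep E b c) (hcd : E c d) (hda : SymStep E d a) : SymStep E a b := by
  have hH := hE.linked_of_two_edges hab hbc hcd hda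
  have hr := hE.refl
  have hS := hE.symStep.refl
  refine hE.symStep_of_step (H := {a, b, c, d}) (fun i hi hf => ?_) (by simp) (by simp)
  have hxxz := fun x hx z hz => (hE.f_succ_of_f hH hi hf (x := x) (z := z) hx hz).1
  have hxzx := fun x hx z hz => (hE.f_succ_of_f hH hi hf (x := x) (z := z) hx hz).2
  have opp : ∀ {p q r s : V}, p ∈ ({a, b, c, d} : Set V) →
      r ∈ ({a, b, c, d} : Set V) → s ∈ ({a, b, c, d} : Set V) → E p q → SymStep E q r → E r s →
      SymStep E s p → SymStep E (C.f (i + 1) s q r) s := by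
    intro p q r s hp hr' hs hpq hqr hrs hsp
    exact hE.between (hE.f_up hi hsp.2 hpq hqr.2 (hr r) (hr r) hrs)
      (hE.f_edge hi (hr s) hqr.1 hrs) (hE.trans (hf p hp r hr' r hr') hsp.symm)
      (hxzx s hs r hr')
  have hd := opp (by simp) (by simp) (by simp) hab hbc hcd hda
  have hb := opp (by simp) (by simp) (by simp) hcd hda hab hbc
  have cls : ∀ x ∈ ({a, b, c, d} : Set V), SymStep E x d ∨ SymStep E x b := by
    rintro x (rfl | rfl | rfl | rfl)
    exacts [.inl hda.symm, .inr (hS _), .inr hbc.symm, .inl (hS _)]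
  have cong : ∀ {x y z x' y' z' : V}, SymStep E x x' → SymStep E y y' → SymStep E z z' →
      SymStep E (C.f (i + 1) x' y' z') x' → SymStep E (C.f (i + 1) x y z) x :=
    fun hx hy hz h => hE.trans (hE.symStep.f_edge hi hx hy hz) (hE.trans h hx.symm)
  intro x hx y hy z hz
  by_cases hyx : SymStep E y x
  · exact cong (hS x) hyx (hS z) (hxxz x hx z hz)
  by_cases hzx : SymStep E z x
  · exact cong (hS x) (hS y) hzx (hxzx x hx y hy)
  rcases cls x hx with h | h
  · have aux : ∀ w ∈ ({a, b, c, d} : Set V), ¬ SymStep E w x → SymStep E w b := fun w hw hn =>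
      (cls w hw).resolve_left fun h' => hn (hE.trans h' h.symm)
    exact cong h (aux y hy hyx) (hE.trans (aux z hz hzx) hbc) hd
  · have aux : ∀ w ∈ ({a, b, c, d} : Set V), ¬ SymStep E w x → SymStep E w d := fun w hw hn =>
      (cls w hw).resolve_right fun h' => hn (hE.trans h' h.symm)
    exact cong h (aux y hy hyx) (hE.trans (aux z hz hzx) hda) hb

end SymTransitive

/-- A compatible relation invariant under its symmetric part, which is transitive. -/
structure Saturated {n : ℕ} (C : ChainTerms V n) (E : V → V → Prop) : Prop
    extends SymTransitive C E where
  sat : ∀ {u u' v' v}, SymStep E u u' → E u' v' → SymStep E v' v → E u v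

/-- Composition with the symmetric part on both sides. -/
def saturate (E : V → V → Prop) : V → V → Prop :=
  Relation.Comp (SymStep E) (Relation.Comp E (SymStep E))

lemma SymTransitive.symStep_saturate {n : ℕ} {C : ChainTerms V n} {E : V → V → Prop}
    (hE : SymTransitive C E) {u v : V} : SymStep (saturate E) u v ↔ SymStep E u v := by
  constructor
  · rintro ⟨⟨a, hua, b, hab, hbv⟩, ⟨c, hvc, d, hcd, hdu⟩⟩
    exact hE.trans hua (hE.trans (hE.symStep_of_two_edges hab (hE.trans hbv hvc) hcd
      (hE.trans hdu hua)) hbv)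
  · intro h
    have hS := hE.symStep.refl
    exact ⟨⟨u, hS u, v, h.1, hS v⟩, ⟨v, hS v, u, h.2, hS u⟩⟩

lemma SymTransitive.saturate {n : ℕ} {C : ChainTerms V n} {E : V → V → Prop}
    (hE : SymTransitive C E) : Saturated C (saturate E) where
  toCompatible := hE.symStep.comp (hE.comp hE.symStep)
  trans h h' := hE.symStep_saturate.2
    (hE.trans (hE.symStep_saturate.1 h) (hE.symStep_saturate.1 h'))
  sat := by
    rintro u u' v' v hu ⟨a, hua, b, hab, hbv⟩ hv
    exact ⟨a, hE.trans (hE.symStep_saturate.1 hu) hua, b, hab,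
      hE.trans hbv (hE.symStep_saturate.1 hv)⟩

namespace Saturated

variable {n : ℕ} {C : ChainTerms V n} {E : V → V → Prop}

lemma linked_of_four_cycle (hE : Saturated C E) {a b c d : V} (hab : E a b) (hbc : E b c)
    (hcd : E c d) (hda : E d a) : Linked E {a, b, c, d} := by
  have hr := hE.refl
  have adj : ∀ {p q}, q ∈ ({a, b, c, d} : Set V) → E p q ∨ E q p →
      ∃ r ∈ ({a, b, c, d} : Set V), ∃ r' ∈ ({a, b, c, d} : Set V),
        (E p r ∨ E r p) ∧ (E p r' ∨ E r' p) ∧ E r q ∧ E q r' :=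
    fun {_ q} hq h => ⟨q, hq, q, hq, h, h, hr q, hr q⟩
  have ha : a ∈ ({a, b, c, d} : Set V) := by simp
  have hb : b ∈ ({a, b, c, d} : Set V) := by simp
  have hc : c ∈ ({a, b, c, d} : Set V) := by simp
  have hd : d ∈ ({a, b, c, d} : Set V) := by simp
  rintro p (rfl | rfl | rfl | rfl) q (rfl | rfl | rfl | rfl)
  exacts [
    adj ha (.inl (hr _)), adj hb (.inl hab),
    ⟨_, hb, _, hd, .inl hab, .inr hda, hbc, hcd⟩, adj hd (.inr hda),
    adj ha (.inr hab), adj hb (.inl (hr _)), adj hc (.inl hbc),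
    ⟨_, hc, _, ha, .inl hbc, .inr hab, hcd, hda⟩,
    ⟨_, hd, _, hb, .inl hcd, .inr hbc, hda, hab⟩, adj hb (.inr hbc),
    adj hc (.inl (hr _)), adj hd (.inl hcd), adj ha (.inl hda),
    ⟨_, ha, _, hc, .inl hda, .inr hcd, hab, hbc⟩, adj hc (.inr hcd),
    adj hd (.inl (hr _))]

lemma f_of_four_cycle (hE : Saturated C E) {i : ℕ} (hi : i ≤ n) {a b c d : V} (hab : E a b)
    (hbc : E b c) (hcd : E c d) (hda : E d a)
    (h₁ : ∀ z ∈ ({a, b, c, d} : Set V), SymStep E (C.f i a a z) a)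
    (h₂ : SymStep E (C.f i a b a) a) :
    ∀ y ∈ ({a, b, c, d} : Set V), ∀ z ∈ ({a, b, c, d} : Set V), SymStep E (C.f i a y z) a := by
  have hr := hE.refl
  have hd : SymStep E (C.f i a b d) a :=
    hE.between (hE.f_edge hi (hr a) hab (hr d)) (hE.f_edge hi (hr a) (hr b) hda)
      (h₁ d (by simp)) h₂
  have hc : SymStep E (C.f i a b c) a :=
    hE.between (hE.f_edge hi (hr a) hab (hr c)) (hE.f_edge hi (hr a) (hr b) hcd)
      (h₁ c (by simp)) hd
  have hb : SymStep E (C.f i a b b) a :=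
    hE.between (hE.f_edge hi (hr a) hab (hr b)) (hE.f_edge hi (hr a) (hr b) hbc)
      (h₁ b (by simp)) hc
  have habz : ∀ z ∈ ({a, b, c, d} : Set V), SymStep E (C.f i a b z) a := by
    rintro z (rfl | rfl | rfl | rfl)
    exacts [h₂, hb, hc, hd]
  have key : ∀ z ∈ ({a, b, c, d} : Set V),
      SymStep E a (C.f i a c z) ∧ SymStep E (C.f i a c z) (C.f i a d z) := by
    intro z hz
    have e₁ : E a (C.f i a c z) := hE.sat (habz z hz).symm
      (hE.f_edge hi (hr a) hbc (hr z)) (hE.symStep.refl _)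
    have e₂ : E (C.f i a c z) (C.f i a d z) := hE.f_edge hi (hr a) hcd (hr z)
    have e₃ : E (C.f i a d z) a := hE.sat (hE.symStep.refl _)
      (hE.f_edge hi (hr a) hda (hr z)) (h₁ z hz)
    exact ⟨hE.three_cycle e₁ e₂ e₃, hE.three_cycle e₂ e₃ e₁⟩
  rintro y (rfl | rfl | rfl | rfl) z hz
  exacts [h₁ z hz, habz z hz, (key z hz).1.symm, (hE.trans (key z hz).1 (key z hz).2).symm]

lemma symStep_of_four_cycle (hE : Saturated C E) {a b c d : V} (hab : E a b) (hbc : E b c)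
    (hcd : E c d) (hda : E d a) : SymStep E a c := by
  have hH := hE.linked_of_four_cycle hab hbc hcd hda
  refine hE.symStep_of_step (H := {a, b, c, d}) (fun i hi hf => ?_) (by simp) (by simp)
  have hxxz := fun x hx z hz => (hE.f_succ_of_f hH hi hf (x := x) (z := z) hx hz).1
  have hxzx := fun x hx z hz => (hE.f_succ_of_f hH hi hf (x := x) (z := z) hx hz).2
  have eb : ({a, b, c, d} : Set V) = {b, c, d, a} := by ext; simp; tauto
  have ec : ({a, b, c, d} : Set V) = {c, d, a, b} := by ext; simp; tauto
  have ed : ({a, b, c, d} : Set V) = {d, a, b, c} := by ext; simp; tauto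
  have ha := hE.f_of_four_cycle hi hab hbc hcd hda (hxxz a (by simp)) (hxzx a (by simp) b (by simp))
  have hb := hE.f_of_four_cycle hi hbc hcd hda hab (eb ▸ hxxz b (by simp))
    (hxzx b (by simp) c (by simp))
  have hc := hE.f_of_four_cycle hi hcd hda hab hbc (ec ▸ hxxz c (by simp))
    (hxzx c (by simp) d (by simp))
  have hd := hE.f_of_four_cycle hi hda hab hbc hcd (ed ▸ hxxz d (by simp))
    (hxzx d (by simp) a (by simp))
  rw [← eb] at hb
  rw [← ec] at hc
  rw [← ed] at hd
  rintro x (rfl | rfl | rfl | rfl)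
  exacts [ha, hb, hc, hd]

lemma symStep_comp_self (hE : Saturated C E) {u v : V} :
    SymStep (Relation.Comp E E) u v ↔ SymStep E u v := by
  constructor
  · rintro ⟨⟨w, huw, hwv⟩, ⟨w', hvw, hwu⟩⟩
    exact hE.symStep_of_four_cycle huw hwv hvw hwu
  · intro h
    exact ⟨⟨u, hE.refl u, h.1⟩, ⟨v, hE.refl v, h.2⟩⟩

lemma comp_self (hE : Saturated C E) : Saturated C (Relation.Comp E E) where
  toCompatible := hE.comp hE.toCompatible
  trans h h' := hE.symStep_comp_self.2
    (hE.trans (hE.symStep_comp_self.1 h) (hE.symStep_comp_self.1 h'))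
  sat := by
    rintro u u' v' v hu ⟨w, huw, hwv⟩ hv
    exact ⟨w, hE.sat (hE.symStep_comp_self.1 hu) huw (hE.symStep.refl w),
      hE.sat (hE.symStep.refl w) hwv (hE.symStep_comp_self.1 hv)⟩

lemma dbl (hE : Saturated C E) (m : ℕ) :
    Saturated C (dbl E m) ∧ ∀ u v, SymStep (DigraphHM4.dbl E m) u v → SymStep E u v := by
  induction m with
  | zero => exact ⟨hE, fun _ _ h => h⟩
  | succ m ih => exact ⟨ih.1.comp_self, fun u v h => ih.2 u v (ih.1.symStep_comp_self.1 h)⟩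

lemma symStep_of_strongEq (hE : Saturated C E) {a b : V} (h : StrongEq E a b) :
    SymStep E a b := by
  obtain ⟨m, hm⟩ := exists_dbl_of_reflTransGen hE.refl h.1
  obtain ⟨k, hk⟩ := exists_dbl_of_reflTransGen hE.refl h.2
  exact (hE.dbl (max m k)).2 a b ⟨dbl_mono hE.refl (le_max_left m k) hm,
    dbl_mono hE.refl (le_max_right m k) hk⟩

end Saturated

lemma Compatible.extremeEq_of_strongEq {n : ℕ} {C : ChainTerms V n} {E : V → V → Prop}
    (hE : Compatible C E) {a b : V} (h : StrongEq E a b) : ExtremeEq E a b := by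
  have hF : SymTransitive C (DigraphHM4.enlarge (ExtremeEq E) E) :=
    { hE.extremeEq.enlarge hE with
      trans := fun h h' => hE.symStep_enlarge_extremeEq.2
        ((hE.symStep_enlarge_extremeEq.1 h).trans (hE.symStep_enlarge_extremeEq.1 h')) }
  have hle : ∀ u v, E u v → DigraphHM4.saturate (DigraphHM4.enlarge (ExtremeEq E) E) u v :=
    fun u v h => ⟨u, hF.symStep.refl u, v, le_enlarge (fun _ => .refl) h, hF.symStep.refl v⟩
  exact hE.symStep_enlarge_extremeEq.1 (hF.symStep_saturate.1
    (hF.saturate.symStep_of_strongEq ⟨Relation.ReflTransGen.mono hle _ _ h.1,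
      Relation.ReflTransGen.mono hle _ _ h.2⟩))

lemma ExtremeEq.strongEq {E : V → V → Prop} {a b : V} (h : ExtremeEq E a b) :
    StrongEq E a b :=
  ⟨Relation.ReflTransGen.mono (fun _ _ h => h.1) _ _ h,
    Relation.ReflTransGen.mono (fun _ _ h => h.1) _ _ h.symm⟩

lemma IsPoly.preserves {E : V → V → Prop} {g : (Fin 6 → V) → V} (hg : IsPoly E g) :
    Preserves E (fun a₁ a₂ a₃ a₄ a₅ a₆ => g ![a₁, a₂, a₃, a₄, a₅, a₆]) := by
  intro a₁ a₂ a₃ a₄ a₅ a₆ b₁ b₂ b₃ b₄ b₅ b₆ h₁ h₂ h₃ h₄ h₅ h₆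
  refine hg _ _ fun i => ?_
  fin_cases i <;> assumption

end

/-- If a reflexive digraph admits, for some `n ≥ 1`, 6-ary polymorphisms
`s₁, …, sₙ` and `t₁, …, tₙ` satisfying `t₁(x,x,y,y,z,z) = x`,
`tᵢ(x,x,y,y,z,z) = sᵢ(x,y,y,z,z,x)`, `sᵢ(x,x,y,y,z,z) = tᵢ(x,y,y,z,z,x)`,
`tᵢ(x,x,y,y,z,z) = tᵢ₋₁(x,y,y,z,z,x)` for `1 < i ≤ n`, and `tₙ(x,y,y,z,z,x) = y`,
then its strong equivalence coincides with its extreme equivalence. -/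
theorem strongEq_eq_extremeEq_of_chain_terms {V : Type*} (E : V → V → Prop)
    (hrefl : ∀ v, E v v) (n : ℕ) (hn : 0 < n) (s ts : Fin n → ((Fin 6 → V) → V))
    (hs : ∀ i : Fin n, IsPoly E (s i))
    (hts : ∀ i : Fin n, IsPoly E (ts i))
    (hids : ∀ x y z : V,
      ts ⟨0, hn⟩ ![x, x, y, y, z, z] = x ∧
      (∀ i : Fin n, ts i ![x, x, y, y, z, z] = s i ![x, y, y, z, z, x]) ∧
      (∀ i : Fin n, s i ![x, x, y, y, z, z] = ts i ![x, y, y, z, z, x]) ∧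
      (∀ i j : Fin n, (i : ℕ) + 1 = (j : ℕ) →
        ts j ![x, x, y, y, z, z] = ts i ![x, y, y, z, z, x]) ∧
      ts ⟨n - 1, Nat.sub_lt hn Nat.one_pos⟩ ![x, y, y, z, z, x] = y) :
    ∀ a b : V, StrongEq E a b ↔ ExtremeEq E a b := by
  intro a b
  refine ⟨fun h => ?_, ExtremeEq.strongEq⟩
  let C : ChainTerms V n :=
    { f := fun i x y z => if i = 0 then x else
        if h : i - 1 < n then ts ⟨i - 1, h⟩ ![x, y, y, z, z, x] else x
      t := fun i a₁ a₂ a₃ a₄ a₅ a₆ =>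
        if h : i < n then ts ⟨i, h⟩ ![a₁, a₂, a₃, a₄, a₅, a₆] else a₁
      s := fun i a₁ a₂ a₃ a₄ a₅ a₆ =>
        if h : i < n then s ⟨i, h⟩ ![a₁, a₂, a₃, a₄, a₅, a₆] else a₁
      f_zero := fun x y z => if_pos rfl
      f_last := fun x y z => by
        simp only [hn.ne', if_false, Nat.sub_lt hn Nat.one_pos, dif_pos]
        exact (hids x y z).2.2.2.2
      t_left := fun i hi x y z => by
        rcases i with _ | i
        · simpa [hn] using (hids x y z).1
        · have hi' : i < n := Nat.lt_of_succ_lt hi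
          simpa [hi, hi'] using (hids x y z).2.2.2.1 ⟨i, hi'⟩ ⟨i + 1, hi⟩ rfl
      t_right := fun i hi x y z => by simp [hi]
      s_left := fun i hi x y z => by
        have h₁ := (hids x y z).2.1 ⟨i, hi⟩
        rcases i with _ | i
        · simpa [hn, (hids x y z).1] using h₁.symm
        · have hi' : i < n := Nat.lt_of_succ_lt hi
          have h₂ := (hids x y z).2.2.2.1 ⟨i, hi'⟩ ⟨i + 1, hi⟩ rfl
          simpa [hi, hi'] using h₁.symm.trans h₂
      s_right := fun i hi x y z => by simpa [hi] using (hids x y z).2.2.1 ⟨i, hi⟩ }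
  have hC : Compatible C E :=
    { refl := hrefl
      t := fun i hi => by simpa only [C, hi, dif_pos] using (hts ⟨i, hi⟩).preserves
      s := fun i hi => by simpa only [C, hi, dif_pos] using (hs ⟨i, hi⟩).preserves }
  exact hC.extremeEq_of_strongEq h

end DigraphHM4
end

section
/- Let n ≥ 2 and let G be a reflexive digraph admitting ternary polymorphisms p₁,…,p_{n−1} satisfying, for all vertices x and y: p₁(x,y,y) = x; pᵢ(x,x,y) = pᵢ₊₁(x,y,y) for all 1 ≤ i ≤ n−2; and p_{n−1}(x,x,y) = y (Hagemann–Mitschke operations). Then the weak equivalence of G coincides with the extreme equivalence of G; equivalently, every weak component of G is extremely connected. -/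
namespace DigraphHM5

/-- `f` is a polymorphism of the digraph `(V, E)`. -/
def IsPoly {V : Type*} (E : V → V → Prop) {n : ℕ} (f : (Fin n → V) → V) : Prop :=
  ∀ a b : Fin n → V, (∀ i, E (a i) (b i)) → E (f a) (f b)

/-- One step of a symmetric path: edges in both directions. -/
def SymStep {V : Type*} (E : V → V → Prop) : V → V → Prop :=
  fun u v => E u v ∧ E v u

/-- The extreme equivalence: being connected by a symmetric path. -/
def ExtremeEq {V : Type*} (E : V → V → Prop) : V → V → Prop :=
  Relation.ReflTransGen (SymStep E)

/-- A ternary polymorphism, applied to three edges. -/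
theorem IsPoly.edge {V : Type*} {E : V → V → Prop} {f : (Fin 3 → V) → V} (hf : IsPoly E f)
    {x x' y y' z z' : V} (hx : E x x') (hy : E y y') (hz : E z z') :
    E (f ![x, y, z]) (f ![x', y', z']) :=
  hf _ _ fun i => by fin_cases i <;> assumption

/-- A symmetric path may be traversed backwards. -/
theorem ExtremeEq.symm {V : Type*} {E : V → V → Prop} {u v : V} (h : ExtremeEq E u v) :
    ExtremeEq E v u :=
  have : Std.Symm (SymStep E) := ⟨fun _ _ h => And.symm h⟩
  Relation.ReflTransGen.stdSymm.symm _ _ h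

/-- Operations satisfying the first two kinds of Hagemann–Mitschke identities are idempotent. -/
theorem idempotent_of_hagemannMitschke {V : Type*} {m : ℕ} (hm : 0 < m)
    {p : Fin m → ((Fin 3 → V) → V)}
    (hfirst : ∀ x y : V, p ⟨0, hm⟩ ![x, y, y] = x)
    (hchain : ∀ i j : Fin m, (i : ℕ) + 1 = (j : ℕ) →
      ∀ x y : V, p i ![x, x, y] = p j ![x, y, y])
    (i : ℕ) (hi : i < m) (x : V) : p ⟨i, hi⟩ ![x, x, x] = x := by
  induction i with
  | zero => exact hfirst x x
  | succ i ih => rw [← hchain ⟨i, by omega⟩ ⟨i + 1, hi⟩ rfl, ih]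

/-- If `d` lies between `a` and `b` and has an edge to `pᵢ(a,a,b)`, then the two are extremely
equivalent. -/
theorem extremeEq_of_edge_hagemannMitschke {V : Type*} {E : V → V → Prop}
    (hrefl : ∀ v, E v v) {m : ℕ} (hm : 0 < m) {p : Fin m → ((Fin 3 → V) → V)}
    (hpoly : ∀ i : Fin m, IsPoly E (p i))
    (hfirst : ∀ x y : V, p ⟨0, hm⟩ ![x, y, y] = x)
    (hchain : ∀ i j : Fin m, (i : ℕ) + 1 = (j : ℕ) →
      ∀ x y : V, p i ![x, x, y] = p j ![x, y, y])
    (i : ℕ) (hi : i < m) {a b d : V} (hab : E a b) (had : E a d) (hdb : E d b)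
    (hd : E d (p ⟨i, hi⟩ ![a, a, b])) : ExtremeEq E d (p ⟨i, hi⟩ ![a, a, b]) := by
  have idem := idempotent_of_hagemannMitschke hm hfirst hchain
  induction i generalizing a d with
  | zero =>
    have h := (hpoly ⟨0, hm⟩).edge had hab (hrefl b)
    rw [hfirst] at h
    exact .single ⟨hd, h⟩
  | succ i ih =>
    have hi' : i < m := by omega
    have hcb := (hpoly ⟨i + 1, hi⟩).edge hab hab (hrefl b)
    rw [idem] at hcb
    have hc := (hpoly ⟨i + 1, hi⟩).edge had hab (hrefl b)
    rw [← hchain ⟨i, hi'⟩ ⟨i + 1, hi⟩ rfl] at hc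
    have hd' := (hpoly ⟨i, hi'⟩).edge (hrefl d) (hrefl d) hdb
    rw [idem] at hd'
    exact (ih hi' hdb (hrefl d) hdb hd').trans (ih hi' hdb hd hcb hc).symm

/-- If a reflexive digraph admits Hagemann–Mitschke polymorphisms `p₁, …, p_{n-1}`
(`n ≥ 2`), i.e. ternary polymorphisms satisfying `p₁(x,y,y) = x`,
`pᵢ(x,x,y) = pᵢ₊₁(x,y,y)` for `1 ≤ i ≤ n-2`, and `p_{n-1}(x,x,y) = y`, then its
weak equivalence (the equivalence generated by the edge relation) coincides with
its extreme equivalence. -/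
theorem weakEq_eq_extremeEq_of_hagemannMitschke {V : Type*} (E : V → V → Prop)
    (hrefl : ∀ v, E v v) (n : ℕ) (hn : 2 ≤ n)
    (p : Fin (n - 1) → ((Fin 3 → V) → V))
    (hpoly : ∀ i : Fin (n - 1), IsPoly E (p i))
    (hfirst : ∀ x y : V, p ⟨0, by omega⟩ ![x, y, y] = x)
    (hchain : ∀ i j : Fin (n - 1), (i : ℕ) + 1 = (j : ℕ) →
      ∀ x y : V, p i ![x, x, y] = p j ![x, y, y])
    (hlast : ∀ x y : V, p ⟨n - 2, by omega⟩ ![x, x, y] = y) :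
    ∀ a b : V, Relation.EqvGen E a b ↔ ExtremeEq E a b := by
  have step : ∀ a b, E a b → ExtremeEq E a b := fun a b h => by
    have hab := extremeEq_of_edge_hagemannMitschke hrefl (by omega) hpoly hfirst hchain
      (n - 2) (by omega) h (hrefl a) h (by rwa [hlast])
    rwa [hlast] at hab
  refine fun a b => ⟨fun h => ?_, fun h => ?_⟩
  · induction h with
    | rel x y h => exact step x y h
    | refl x => exact .refl
    | symm x y _ ih => exact ih.symm
    | trans x y z _ _ ihxy ihyz => exact ihxy.trans ihyz
  · induction h with
    | refl => exact .refl _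
    | tail _ h ih => exact ih.trans _ _ _ (.rel _ _ h.1)

end DigraphHM5
end
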